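/- arXiv:2112.12411 — 8 statements merged into one kernel-verified Lean document; each statement's English description precedes it below -/
import Mathlib

section
/- Let 𝒯 be a finite set of T ≥ 2 targets, σ ∈ (0,1], n ≥ 1 and d ∈ ℕ. For any ε > 0, the algorithm A_σ^{n,d} satisfies (ε,δ)-differential privacy for every δ satisfying δ ≥ (1/(σ·n)) · Σ_{m=1}^{n} (m/(m+d)) · C(n,m) · σ^m · (1−σ)^{n−m} · (b²/(4a)) · exp(−2(m+d)·a²/b²), where a = e^ε − 1 and b = (1−σ)·T·(1+e^ε) + 2σ·(e^ε − 1). -/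
section
open Finset MvPolynomial

lemma aux_hoeff {α : Type*} [Fintype α] [Nonempty α] (L : α → ℝ) (lo hi μ l : ℝ)
    (h : ∀ y, L y ∈ Set.Icc lo hi) (hμ : (1 / (Fintype.card α : ℝ)) * ∑ y, L y = μ) :
    (1 / (Fintype.card α : ℝ)) * ∑ y, Real.exp (l * L y)
      ≤ Real.exp (l * μ + l ^ 2 * (hi - lo) ^ 2 / 8) := by
  classical
  let _ : MeasurableSpace α := ⊤
  have : MeasurableSingletonClass α := ⟨fun _ => trivial⟩
  let p : MeasureTheory.Measure α := (PMF.uniformOfFintype α).toMeasure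
  have hint : ∀ g : α → ℝ, ∫ y, g y ∂p = (1 / (Fintype.card α : ℝ)) * ∑ y, g y := by
    intro g
    rw [PMF.integral_eq_sum, Finset.mul_sum]
    simp
  have key := (ProbabilityTheory.hasSubgaussianMGF_of_mem_Icc (μ := p) (X := L) (a := lo) (b := hi)
    (measurable_from_top.aemeasurable) (Filter.Eventually.of_forall h)).mgf_le l
  simp only [ProbabilityTheory.mgf] at key
  rw [hint, hint, hμ] at key
  have e : ∑ y, Real.exp (l * L y) = Real.exp (l * μ) * ∑ y, Real.exp (l * (L y - μ)) := by
    rw [Finset.mul_sum]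
    refine Finset.sum_congr rfl fun y _ => ?_
    rw [← Real.exp_add]; ring_nf
  rw [e, Real.exp_add]
  have : Real.exp ((((‖hi - lo‖₊ / 2) ^ 2 : NNReal) : ℝ) * l ^ 2 / 2) = Real.exp (l ^ 2 * (hi - lo) ^ 2 / 8) := by
    congr 1
    push_cast
    rw [div_pow, Real.norm_eq_abs, sq_abs]; ring
  rw [this] at key
  calc _ = Real.exp (l * μ) * (1 / (Fintype.card α : ℝ) * ∑ y, Real.exp (l * (L y - μ))) := by ring
    _ ≤ _ := by gcongr

noncomputable def aphi {α : Type*} [DecidableEq α] (O : Finset (Multiset α)) :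
    MvPolynomial α ℝ →ₗ[ℝ] ℝ := ∑ S ∈ O, lcoeff ℝ (Multiset.toFinsupp S)

lemma aux_mon {α : Type*} [DecidableEq α] (S : Multiset α) :
    (S.map (X : α → MvPolynomial α ℝ)).prod = monomial (Multiset.toFinsupp S) 1 := by
  induction S using Multiset.induction with
  | empty => simp
  | cons a S ih =>
    rw [Multiset.map_cons, Multiset.prod_cons, ih, ← Multiset.singleton_add, map_add,
      Multiset.toFinsupp_singleton, X, monomial_mul, one_mul]

lemma aphi_mon {α : Type*} [DecidableEq α] (O : Finset (Multiset α)) (S : Multiset α) :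
    aphi O ((S.map (X : α → MvPolynomial α ℝ)).prod) = ∑ S' ∈ O, if S = S' then 1 else 0 := by
  rw [aux_mon, aphi, LinearMap.sum_apply]
  refine Finset.sum_congr rfl fun S' _ => ?_
  simp [lcoeff_apply, coeff_monomial]

lemma aux_prod {α : Type*} [DecidableEq α] {n : ℕ} (f : Fin n → α) :
    ∏ i, (X (f i) : MvPolynomial α ℝ) = ((↑(List.ofFn f) : Multiset α).map X).prod := by
  simp [List.prod_ofFn]

lemma aphi_range {α : Type*} [DecidableEq α] (O : Finset (Multiset α)) (S : Multiset α) :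
    0 ≤ aphi O ((S.map (X : α → MvPolynomial α ℝ)).prod) ∧
     aphi O ((S.map (X : α → MvPolynomial α ℝ)).prod) ≤ 1 := by
  rw [aphi_mon, Finset.sum_ite_eq]
  split_ifs <;> simp

lemma aux_pow_sum {α : Type*} [Fintype α] [DecidableEq α] {R : Type*} [CommRing R] {n : ℕ}
    (c : Fin n → α → R) :
    ∏ i, ∑ y, c i y = ∑ f : Fin n → α, ∏ i, c i (f i) := by
  rw [Finset.prod_univ_sum, Fintype.piFinset_univ]

/-- output law as polynomial -/
lemma aux_P {α : Type*} [Fintype α] [DecidableEq α] {n d : ℕ} (O : Finset (Multiset α))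
    (q : Fin n → α → ℝ) (u : ℝ) :
    ∑ S ∈ O, (∑ f : Fin n → α, ∑ g : Fin d → α, (∏ i, q i (f i)) * u ^ d *
        (if (↑(List.ofFn f) : Multiset α) + (↑(List.ofFn g) : Multiset α) = S
         then 1 else 0)) =
      aphi O ((∏ i, ∑ y, C (q i y) * X y) * (∑ y, C u * X y) ^ d) := by
  have h2 : (∑ y : α, C u * X y : MvPolynomial α ℝ) ^ d = ∏ _i : Fin d, ∑ y : α, C u * X y := by simp
  rw [h2, aux_pow_sum, aux_pow_sum, Finset.sum_mul_sum, map_sum, Finset.sum_comm]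
  refine Finset.sum_congr rfl fun f _ => ?_
  rw [map_sum, Finset.sum_comm]
  refine Finset.sum_congr rfl fun g _ => ?_
  have : (∏ i, C (q i (f i)) * X (f i)) * ∏ i, C u * X (g i) =
      ((∏ i, q i (f i)) * u ^ d) • (((↑(List.ofFn f) : Multiset α) + (↑(List.ofFn g) : Multiset α)).map
        (X : α → MvPolynomial α ℝ)).prod := by
    rw [Multiset.map_add, Multiset.prod_add, ← aux_prod, ← aux_prod, smul_eq_C_mul,
      Finset.prod_mul_distrib, Finset.prod_mul_distrib]
    simp only [map_mul, map_prod, map_pow, Finset.prod_const, Finset.card_univ, Fintype.card_fin]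
    ring
  rw [this, map_smul, aphi_mon, smul_eq_mul, Finset.mul_sum]

lemma aux_bound {α : Type*} [Fintype α] [DecidableEq α] (O : Finset (Multiset α)) (Z : Multiset α)
    (L : α → ℝ) (u l : ℝ) (hu : 0 ≤ u) (hl : 0 < l) (N : ℕ) :
    aphi O ((∑ y, C (u * L y) * X y) * (∑ y, C u * X y) ^ N * (Z.map X).prod) ≤
      1 / ((N : ℝ) + 1) * ((u * ∑ y, Real.exp (l * L y)) ^ (N + 1) / l) := by
  set Q : MvPolynomial α ℝ := (∑ y, C (u * L y) * X y) * (∑ y, C u * X y) ^ N * (Z.map X).prod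
  have hj : ∀ j : Fin (N + 1), (∑ y, C (u * L y) * X y) * (∑ y, C u * X y) ^ N =
      ∑ h : Fin (N + 1) → α, (u ^ (N + 1) * L (h j)) • ∏ k, (X (h k) : MvPolynomial α ℝ) := by
    intro j
    have e1 : ((∑ y, C (u * L y) * X y) * (∑ y, C u * X y) ^ N : MvPolynomial α ℝ) =
       ∏ k : Fin (N + 1), ∑ y, C (u * (if k = j then L y else 1)) * X y := by
      rw [← Finset.mul_prod_erase _ _ (Finset.mem_univ j)]
      congr 1
      · simp
      · rw [Finset.prod_congr rfl (g := fun _ => (∑ y, C u * X y : MvPolynomial α ℝ))]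
        · simp
        · intro k hk
          simp [Finset.ne_of_mem_erase hk]
    rw [e1, aux_pow_sum]
    refine Finset.sum_congr rfl fun h _ => ?_
    rw [Finset.prod_mul_distrib, ← map_prod, Finset.prod_mul_distrib, smul_eq_C_mul]
    simp
  have hsum : ((N : ℝ) + 1) * aphi O Q = ∑ h : Fin (N + 1) → α,
      u ^ (N + 1) * (∑ j, L (h j)) * aphi O (((↑(List.ofFn h) + Z : Multiset α)).map X).prod := by
    have : ((N : ℝ) + 1) * aphi O Q = ∑ _j : Fin (N + 1), aphi O Q := by simp
    rw [this]
    have : ∀ j : Fin (N + 1), aphi O Q = ∑ h : Fin (N + 1) → α,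
      u ^ (N + 1) * L (h j) * aphi O (((↑(List.ofFn h) + Z : Multiset α)).map X).prod := by
      intro j
      simp only [Q]
      rw [hj j, Finset.sum_mul, map_sum]
      refine Finset.sum_congr rfl fun h _ => ?_
      rw [smul_mul_assoc, map_smul, aux_prod, Multiset.map_add, Multiset.prod_add, smul_eq_mul]
    rw [Finset.sum_congr rfl (fun j _ => this j), Finset.sum_comm]
    refine Finset.sum_congr rfl fun h _ => ?_
    rw [Finset.mul_sum, Finset.sum_mul]
  have hle : ((N : ℝ) + 1) * aphi O Q ≤ (u * ∑ y, Real.exp (l * L y)) ^ (N + 1) / l := by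
    rw [hsum]
    have : (u * ∑ y, Real.exp (l * L y)) ^ (N + 1) / l = ∑ h : Fin (N + 1) → α,
        u ^ (N + 1) * (Real.exp (l * ∑ j, L (h j)) / l) := by
      have e2 : (∑ y, Real.exp (l * L y)) ^ (N + 1) = ∏ _i : Fin (N + 1), ∑ y, Real.exp (l * L y) := by simp
      rw [mul_pow, e2, aux_pow_sum, Finset.mul_sum, Finset.sum_div]
      refine Finset.sum_congr rfl fun h _ => ?_
      rw [Finset.mul_sum, Real.exp_sum]; ring
    rw [this]
    refine Finset.sum_le_sum fun h _ => ?_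
    rw [mul_assoc]
    refine mul_le_mul_of_nonneg_left ?_ (by positivity)
    obtain ⟨h0, h1⟩ := aphi_range O (↑(List.ofFn h) + Z : Multiset α)
    set s := ∑ j, L (h j)
    have h3 : s ≤ Real.exp (l * s) / l := by
      rw [le_div_iff₀ hl]
      have := Real.add_one_le_exp (l * s)
      linarith
    have h4 : 0 ≤ Real.exp (l * s) / l := by positivity
    calc _ ≤ Real.exp (l * s) / l * aphi O (((↑(List.ofFn h) + Z : Multiset α)).map X).prod := by gcongr
      _ ≤ _ := mul_le_of_le_one_right h4 h1
  rw [div_mul_eq_mul_div, one_mul, le_div_iff₀ (by positivity)]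
  linarith

lemma aux_core {α ι : Type*} [Fintype α] [DecidableEq α] [DecidableEq ι] (O : Finset (Multiset α))
    (L : α → ℝ) (u l s : ℝ) (hu : 0 ≤ u) (hl : 0 < l) (hs0 : 0 ≤ s) (hs1 : s ≤ 1) (d : ℕ)
    (E : Finset ι) (xs : ι → α) :
    aphi O ((∑ y, C (u * L y) * X y) *
      (∏ i ∈ E, (C s * (∑ y, C u * X y) + C (1 - s) * X (xs i))) * (∑ y, C u * X y) ^ d) ≤
    ∑ k ∈ Finset.range (E.card + 1), (E.card.choose k : ℝ) * (s ^ k * (1 - s) ^ (E.card - k) *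
      (1 / (((k + d : ℕ) : ℝ) + 1) * ((u * ∑ y, Real.exp (l * L y)) ^ (k + d + 1) / l))) := by
  set V : MvPolynomial α ℝ := ∑ y, C (u * L y) * X y with hV
  set U : MvPolynomial α ℝ := ∑ y, C u * X y with hU
  have h := Finset.sum_powerset_apply_card (fun k => s ^ k * (1 - s) ^ (E.card - k) *
      (1 / (((k + d : ℕ) : ℝ) + 1) * ((u * ∑ y, Real.exp (l * L y)) ^ (k + d + 1) / l))) (x := E)
  simp only [nsmul_eq_mul] at h
  rw [← h, Finset.prod_add, Finset.mul_sum, Finset.sum_mul, map_sum]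
  refine Finset.sum_le_sum fun B hB => ?_
  have hB' := Finset.mem_powerset.1 hB
  have e : V * ((∏ i ∈ B, C s * U) * ∏ i ∈ E \ B, C (1 - s) * X (xs i)) * U ^ d =
      (s ^ B.card * (1 - s) ^ (E.card - B.card)) •
        (V * U ^ (B.card + d) * ((((E \ B).val.map xs)).map X).prod) := by
    rw [smul_eq_C_mul, Finset.prod_mul_distrib, Finset.prod_const, Finset.prod_const,
      Finset.prod_mul_distrib, Finset.prod_const, Finset.card_sdiff_of_subset hB', Multiset.map_map]
    simp only [map_mul, map_pow, Finset.prod, Function.comp_def]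
    ring
  rw [e, map_smul, smul_eq_mul]
  have h1 : 0 ≤ 1 - s := by linarith
  exact mul_le_mul_of_nonneg_left (aux_bound O _ L u l hu hl _) (by positivity)

lemma aux_split {α : Type*} [Fintype α] [DecidableEq α] (t : α) (s T : ℝ) (r : α → ℝ)
    (hr : ∀ y, r y = (1 - s) * (if y = t then 1 else 0) + s / T) :
    (∑ y, C (r y) * X y : MvPolynomial α ℝ) = C s * (∑ y, C (1 / T) * X y) + C (1 - s) * X t := by
  rw [Finset.mul_sum]
  have : (C (1 - s) * X t : MvPolynomial α ℝ) = ∑ y, C ((1 - s) * (if y = t then 1 else 0)) * X y := by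
    rw [Finset.sum_eq_single t]
    · simp
    · intro y _ hy; simp [hy]
    · simp
  rw [this, ← Finset.sum_add_distrib]
  refine Finset.sum_congr rfl fun y _ => ?_
  rw [hr, ← mul_assoc, ← map_mul, ← add_mul, ← map_add]
  congr 2; ring
end



/-- The shuffle algorithm `A_σ^{n,d}`: each of `n` true targets is passed through the
randomized-response local randomizer `r`, `d` i.i.d. uniform dummy targets are added, and
the output is the resulting multiset of `n + d` targets. For any `ε > 0` it satisfies
`(ε,δ)`-DP for every `δ` at least the stated bound, where `a = e^ε - 1` and
`b = (1-σ)·T·(1+e^ε) + 2σ·(e^ε - 1)`. -/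
theorem stmt3 {𝒯 : Type*} [Fintype 𝒯] [DecidableEq 𝒯]
    (T : ℕ) (hT : T = Fintype.card 𝒯) (hT2 : 2 ≤ T)
    (σ : ℝ) (hσ0 : 0 < σ) (hσ1 : σ ≤ 1)
    (n : ℕ) (hn : 1 ≤ n) (d : ℕ)
    (r : 𝒯 → 𝒯 → ℝ)
    (hr : ∀ t y, r t y = (1 - σ) * (if y = t then 1 else 0) + σ / (T : ℝ))
    (P : (Fin n → 𝒯) → Multiset 𝒯 → ℝ)
    (hP : ∀ x S, P x S = ∑ f : Fin n → 𝒯, ∑ g : Fin d → 𝒯,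
      (∏ i, r (x i) (f i)) * (1 / (T : ℝ)) ^ d *
        (if (↑(List.ofFn f) : Multiset 𝒯) + (↑(List.ofFn g) : Multiset 𝒯) = S
         then 1 else 0))
    (ε δ : ℝ) (hε : 0 < ε)
    (a b : ℝ) (ha : a = Real.exp ε - 1)
    (hb : b = (1 - σ) * (T : ℝ) * (1 + Real.exp ε) + 2 * σ * (Real.exp ε - 1))
    (hδ : δ ≥ (1 / (σ * (n : ℝ))) * ∑ m ∈ Finset.Icc 1 n,
      ((m : ℝ) / ((m : ℝ) + (d : ℝ))) * ((n.choose m : ℕ) : ℝ) * σ ^ m *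
        (1 - σ) ^ (n - m) * (b ^ 2 / (4 * a)) *
        Real.exp (-(2 * ((m : ℝ) + (d : ℝ)) * a ^ 2) / b ^ 2))
    (x x' : Fin n → 𝒯) (i₀ : Fin n) (hneq : x i₀ ≠ x' i₀)
    (hsame : ∀ i, i ≠ i₀ → x i = x' i)
    (𝒪 : Finset (Multiset 𝒯)) :
    ∑ S ∈ 𝒪, P x S ≤ Real.exp ε * ∑ S ∈ 𝒪, P x' S + δ := by
  have hTpos : (0 : ℝ) < T := by exact_mod_cast (by omega : 0 < T)
  have : Nonempty 𝒯 := ⟨x i₀⟩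
  have ha0 : 0 < a := by
    rw [ha]; have := Real.add_one_lt_exp hε.ne'; linarith
  have hexp : Real.exp ε = a + 1 := by rw [ha]; ring
  have h1s : 0 ≤ 1 - σ := by linarith
  have hw0 : 0 ≤ (1 - σ) * (T : ℝ) * (1 + Real.exp ε) := by positivity
  have hb0 : 0 < b := by
    rw [hb, ← ha]
    have : 0 < 2 * σ * a := by positivity
    linarith
  let L : 𝒯 → ℝ := fun y => T * (r (x i₀) y - Real.exp ε * r (x' i₀) y)
  let l : ℝ := 4 * a / b ^ 2
  have hl : 0 < l := by positivity
  -- one-step moment generating function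
  have hG : 1 / (T : ℝ) * ∑ y, Real.exp (l * L y) ≤ Real.exp (-(2 * a ^ 2) / b ^ 2) := by
    have hmean : (1 / (Fintype.card 𝒯 : ℝ)) * ∑ y, L y = -a := by
      rw [← hT]
      simp only [L, hr]
      rw [← Finset.mul_sum, ← mul_assoc, one_div, inv_mul_cancel₀ hTpos.ne', one_mul,
        Finset.sum_sub_distrib, ← Finset.mul_sum, Finset.sum_add_distrib, Finset.sum_add_distrib,
        ← Finset.mul_sum, ← Finset.mul_sum]
      simp only [Finset.sum_ite_eq', Finset.mem_univ, if_true, Finset.sum_const, Finset.card_univ,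
        ← hT, nsmul_eq_mul]
      rw [hexp]
      field_simp
      ring
    have hmem : ∀ y, L y ∈ Set.Icc (-(σ * a) - (1 - σ) * T * Real.exp ε)
        (-(σ * a) + (1 - σ) * T) := by
      intro y
      have e : L y = -(σ * a) + (1 - σ) * T * (if y = x i₀ then 1 else 0)
          - (1 - σ) * T * Real.exp ε * (if y = x' i₀ then 1 else 0) := by
        simp only [L, hr]
        rw [hexp]
        field_simp
        ring
      have p1 : 0 ≤ (1 - σ) * (T : ℝ) := by positivity
      have p2 : 0 ≤ (1 - σ) * (T : ℝ) * Real.exp ε := by positivity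
      rw [e]
      constructor <;> split_ifs <;> linarith
    have h := aux_hoeff L _ _ _ l hmem hmean
    rw [← hT] at h
    refine h.trans (Real.exp_le_exp.2 ?_)
    have e1 : (-(σ * a) + (1 - σ) * T - (-(σ * a) - (1 - σ) * T * Real.exp ε))
        = (1 - σ) * (T : ℝ) * (1 + Real.exp ε) := by ring
    rw [e1]
    have h2 : ((1 - σ) * (T : ℝ) * (1 + Real.exp ε)) ^ 2 ≤ b ^ 2 := by
      refine pow_le_pow_left₀ hw0 ?_ 2
      rw [hb, ← ha]
      have : 0 < 2 * σ * a := by positivity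
      linarith
    calc l * -a + l ^ 2 * ((1 - σ) * (T : ℝ) * (1 + Real.exp ε)) ^ 2 / 8
        ≤ l * -a + l ^ 2 * b ^ 2 / 8 := by gcongr
      _ = _ := by
          have hl' : l = 4 * a / b ^ 2 := rfl
          clear_value l
          subst hl'
          field_simp
          ring
  have hG0 : 0 ≤ 1 / (T : ℝ) * ∑ y, Real.exp (l * L y) :=
    mul_nonneg (one_div_pos.2 hTpos).le (Finset.sum_nonneg fun y _ => (Real.exp_pos _).le)
  -- the two output laws
  have hlaw : ∀ z : Fin n → 𝒯, ∑ S ∈ 𝒪, P z S = aphi 𝒪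
      ((∏ i, ∑ y, MvPolynomial.C (r (z i) y) * MvPolynomial.X y) *
        (∑ y, MvPolynomial.C (1 / (T : ℝ)) * MvPolynomial.X y) ^ d) := by
    intro z
    rw [← aux_P 𝒪 (fun i => r (z i)) (1 / (T : ℝ))]
    exact Finset.sum_congr rfl fun S _ => hP z S
  have hdiff : ∑ S ∈ 𝒪, P x S - Real.exp ε * ∑ S ∈ 𝒪, P x' S = aphi 𝒪
      ((∑ y, MvPolynomial.C (1 / (T : ℝ) * L y) * MvPolynomial.X y) *
      (∏ i ∈ Finset.univ.erase i₀, (MvPolynomial.C σ *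
        (∑ y, MvPolynomial.C (1 / (T : ℝ)) * MvPolynomial.X y) +
          MvPolynomial.C (1 - σ) * MvPolynomial.X (x i))) *
        (∑ y, MvPolynomial.C (1 / (T : ℝ)) * MvPolynomial.X y) ^ d) := by
    rw [hlaw, hlaw, ← smul_eq_mul (Real.exp ε), ← map_smul, ← map_sub]
    congr 1
    have hE : ∏ i ∈ Finset.univ.erase i₀, (∑ y, MvPolynomial.C (r (x' i) y) * MvPolynomial.X y) =
        ∏ i ∈ Finset.univ.erase i₀, (∑ y, MvPolynomial.C (r (x i) y) * MvPolynomial.X y) :=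
      Finset.prod_congr rfl fun i hi => by rw [hsame i (Finset.ne_of_mem_erase hi)]
    rw [← Finset.mul_prod_erase _ _ (Finset.mem_univ i₀),
      ← Finset.mul_prod_erase _ (fun i => ∑ y, MvPolynomial.C (r (x' i) y) * MvPolynomial.X y)
        (Finset.mem_univ i₀), hE]
    have hE2 : ∏ i ∈ Finset.univ.erase i₀, (∑ y, MvPolynomial.C (r (x i) y) * MvPolynomial.X y) =
        ∏ i ∈ Finset.univ.erase i₀, (MvPolynomial.C σ *
        (∑ y, MvPolynomial.C (1 / (T : ℝ)) * MvPolynomial.X y) +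
          MvPolynomial.C (1 - σ) * MvPolynomial.X (x i)) :=
      Finset.prod_congr rfl fun i _ => aux_split (x i) σ T (r (x i)) (hr (x i))
    rw [hE2]
    have hV : (∑ y, MvPolynomial.C (1 / (T : ℝ) * L y) * MvPolynomial.X y : MvPolynomial 𝒯 ℝ) =
        ∑ y, MvPolynomial.C (r (x i₀) y) * MvPolynomial.X y -
        MvPolynomial.C (Real.exp ε) * ∑ y, MvPolynomial.C (r (x' i₀) y) * MvPolynomial.X y := by
      rw [Finset.mul_sum, ← Finset.sum_sub_distrib]
      refine Finset.sum_congr rfl fun y _ => ?_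
      have hLy : 1 / (T : ℝ) * L y = r (x i₀) y - Real.exp ε * r (x' i₀) y := by
        simp only [L]; field_simp
      rw [hLy, map_sub, map_mul]
      ring
    rw [hV, MvPolynomial.smul_eq_C_mul]
    ring
  have hcore := aux_core 𝒪 L (1 / (T : ℝ)) l σ (by positivity) hl hσ0.le hσ1 d
    (Finset.univ.erase i₀) x
  rw [← hdiff] at hcore
  have hcard : (Finset.univ.erase i₀ : Finset (Fin n)).card = n - 1 := by
    simp
  rw [hcard] at hcore
  have hfin : ∑ k ∈ Finset.range (n - 1 + 1), ((n - 1).choose k : ℝ) *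
      (σ ^ k * (1 - σ) ^ (n - 1 - k) * (1 / (((k + d : ℕ) : ℝ) + 1) *
        ((1 / (T : ℝ) * ∑ y, Real.exp (l * L y)) ^ (k + d + 1) / l))) ≤
      (1 / (σ * (n : ℝ))) * ∑ m ∈ Finset.Icc 1 n,
      ((m : ℝ) / ((m : ℝ) + (d : ℝ))) * ((n.choose m : ℕ) : ℝ) * σ ^ m *
        (1 - σ) ^ (n - m) * (b ^ 2 / (4 * a)) *
        Real.exp (-(2 * ((m : ℝ) + (d : ℝ)) * a ^ 2) / b ^ 2) := by
    obtain ⟨N, rfl⟩ : ∃ N, n = N + 1 := ⟨n - 1, by omega⟩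
    rw [Nat.add_sub_cancel, ← Finset.Ico_add_one_right_eq_Icc,
      Finset.sum_Ico_eq_sum_range, Nat.add_sub_cancel, Finset.mul_sum (Finset.range (N + 1))]
    refine Finset.sum_le_sum fun k hk => ?_
    rw [add_comm 1 k]
    have hch : ((N : ℝ) + 1) * (N.choose k : ℝ) = ((N + 1).choose (k + 1) : ℝ) * ((k : ℝ) + 1) := by
      exact_mod_cast Nat.add_one_mul_choose_eq N k
    have hpow : (1 / (T : ℝ) * ∑ y, Real.exp (l * L y)) ^ (k + d + 1) ≤
        Real.exp (-(2 * (((k + 1 : ℕ) : ℝ) + (d : ℝ)) * a ^ 2) / b ^ 2) := by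
      refine (pow_le_pow_left₀ hG0 hG _).trans_eq ?_
      rw [← Real.exp_nat_mul]
      congr 1
      push_cast
      ring
    set e := Real.exp (-(2 * (((k + 1 : ℕ) : ℝ) + (d : ℝ)) * a ^ 2) / b ^ 2)
    have hsub : N + 1 - (k + 1) = N - k := by omega
    rw [hsub]
    have hc : (N.choose k : ℝ) = ((N + 1).choose (k + 1) : ℝ) * ((k : ℝ) + 1) / ((N : ℝ) + 1) := by
      field_simp; linarith
    calc _ ≤ (N.choose k : ℝ) * (σ ^ k * (1 - σ) ^ (N - k) * (1 / (((k + d : ℕ) : ℝ) + 1) *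
        (e / l))) := by gcongr
      _ = _ := by
        rw [hc]
        simp only [l]
        have : (k : ℝ) + 1 + d ≠ 0 := by positivity
        have : (k : ℝ) + d + 1 ≠ 0 := by positivity
        push_cast
        rw [show (k : ℝ) + 1 + d = k + d + 1 by ring]
        field_simp
        ring
  linarith
end

section
/- Let 𝒯 be a finite set of T ≥ 2 targets, n ≥ 1 and d ∈ ℕ. For any ε > 0, the algorithm A_0^{n,d} (i.e., the shuffle algorithm with sampling parameter σ = 0, so each source always sends its true target) satisfies (ε,δ)-differential privacy for every δ satisfying δ ≥ (1/(d+1)) · (b²/(4a)) · exp(−2(d+1)·a²/b²), where a = e^ε − 1 and b = T·(1+e^ε). -/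
theorem hoeff_unif {α : Type*} [Fintype α] [Nonempty α] (w : α → ℝ) (p q l : ℝ)
    (hw : ∀ t, w t ∈ Set.Icc p q) :
    ∑ t, Real.exp (l * w t) ≤ (Fintype.card α : ℝ) *
      Real.exp (l * ((∑ t, w t) / Fintype.card α) + l ^ 2 * (q - p) ^ 2 / 8) := by
  letI : MeasurableSpace α := ⊤
  have hc : (0 : ℝ) < Fintype.card α := by exact_mod_cast Fintype.card_pos
  set μ := (PMF.uniformOfFintype α).toMeasure with hμ
  have hint : ∀ f : α → ℝ, ∫ t, f t ∂μ = (∑ t, f t) / Fintype.card α := by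
    intro f
    rw [hμ, PMF.integral_eq_sum]
    simp [Finset.sum_div, Finset.mul_sum, div_eq_inv_mul]
  have h := ProbabilityTheory.hasSubgaussianMGF_of_mem_Icc (μ := μ) (X := w) (a := p) (b := q)
    (measurable_from_top.aemeasurable) (Filter.Eventually.of_forall hw)
  have h2 := h.mgf_le l
  rw [ProbabilityTheory.mgf, hint, hint, div_le_iff₀ hc] at h2
  have e : ∀ t, Real.exp (l * w t) = Real.exp (l * ((∑ t, w t) / Fintype.card α)) *
      Real.exp (l * (w t - (∑ t, w t) / Fintype.card α)) := by
    intro t; rw [← Real.exp_add]; congr 1; ring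
  rw [Finset.sum_congr rfl (fun t _ => e t), ← Finset.mul_sum, Real.exp_add]
  calc _ ≤ _ := mul_le_mul_of_nonneg_left h2 (Real.exp_pos _).le
    _ = _ := by
      have : ((((‖q - p‖₊ / 2) ^ 2 : NNReal) : ℝ)) * l ^ 2 / 2 = l ^ 2 * (q - p) ^ 2 / 8 := by
        push_cast
        rw [div_pow, Real.norm_eq_abs, sq_abs]; ring
      rw [this]; ring

theorem coe_ofFn_sum {α : Type*} {m : ℕ} (h : Fin m → α) :
    (↑(List.ofFn h) : Multiset α) = ∑ i, ({h i} : Multiset α) := by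
  induction m with
  | zero => simp
  | succ m ih =>
    rw [List.ofFn_succ, Fin.sum_univ_succ, ← ih]
    simp [← Multiset.cons_coe]

theorem symm_sum {α : Type*} [Fintype α] [DecidableEq α] (d : ℕ) (u : α) (F : Multiset α → ℝ) :
    ((d : ℝ) + 1) * ∑ g : Fin d → α, F ({u} + ∑ i, {g i}) =
      ∑ h : Fin (d + 1) → α, (∑ j, if h j = u then (1 : ℝ) else 0) * F (∑ i, {h i}) := by
  simp_rw [Finset.sum_mul]
  rw [Finset.sum_comm]
  have key : ∀ j : Fin (d + 1), ∑ h : Fin (d + 1) → α,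
      (if h j = u then (1 : ℝ) else 0) * F (∑ i, {h i}) =
        ∑ g : Fin d → α, F ({u} + ∑ i, {g i}) := by
    intro j
    rw [← (Fin.insertNthEquiv (fun _ => α) j).sum_comp, Fintype.sum_prod_type, Finset.sum_eq_single u]
    · refine Finset.sum_congr rfl fun g _ => ?_
      rw [Fin.sum_univ_succAbove _ j]
      simp
    · intro t _ ht
      simp [ht]
    · simp
  rw [Finset.sum_congr rfl (fun j _ => key j)]
  simp

/-- The shuffle algorithm `A_0^{n,d}` with sampling parameter `σ = 0`: each source keeps
its true target, `d` i.i.d. uniform dummy targets are added, and the output is the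
resulting multiset of `n + d` targets. For any `ε > 0` it satisfies `(ε,δ)`-DP for every
`δ ≥ (1/(d+1))·(b²/(4a))·exp(-2(d+1)a²/b²)`, where `a = e^ε - 1` and `b = T·(1+e^ε)`. -/
theorem stmt4 {𝒯 : Type*} [Fintype 𝒯] [DecidableEq 𝒯]
    (T : ℕ) (hT : T = Fintype.card 𝒯) (hT2 : 2 ≤ T)
    (n : ℕ) (hn : 1 ≤ n) (d : ℕ)
    (P : (Fin n → 𝒯) → Multiset 𝒯 → ℝ)
    (hP : ∀ x S, P x S = ∑ g : Fin d → 𝒯,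
      (1 / (T : ℝ)) ^ d *
        (if (↑(List.ofFn x) : Multiset 𝒯) + (↑(List.ofFn g) : Multiset 𝒯) = S
         then 1 else 0))
    (ε δ : ℝ) (hε : 0 < ε)
    (a b : ℝ) (ha : a = Real.exp ε - 1)
    (hb : b = (T : ℝ) * (1 + Real.exp ε))
    (hδ : δ ≥ (1 / ((d : ℝ) + 1)) * (b ^ 2 / (4 * a)) *
      Real.exp (-(2 * ((d : ℝ) + 1) * a ^ 2) / b ^ 2))
    (x x' : Fin n → 𝒯) (i₀ : Fin n) (hneq : x i₀ ≠ x' i₀)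
    (hsame : ∀ i, i ≠ i₀ → x i = x' i)
    (𝒪 : Finset (Multiset 𝒯)) :
    ∑ S ∈ 𝒪, P x S ≤ Real.exp ε * ∑ S ∈ 𝒪, P x' S + δ := by
  haveI : Nonempty 𝒯 := ⟨x i₀⟩
  have hTpos : (0 : ℝ) < T := by exact_mod_cast (by omega : 0 < T)
  have hm : (0 : ℝ) < (d : ℝ) + 1 := by positivity
  set E := Real.exp ε with hE
  have hE1 : 1 < E := Real.one_lt_exp_iff.mpr hε
  have hapos : 0 < a := by rw [ha]; linarith
  have hbpos : 0 < b := by rw [hb]; positivity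
  set C : Multiset 𝒯 := ∑ i ∈ Finset.univ.erase i₀, ({x i} : Multiset 𝒯) with hC
  set F : Multiset 𝒯 → ℝ := fun M => if C + M ∈ 𝒪 then 1 else 0 with hF
  have hx : (↑(List.ofFn x) : Multiset 𝒯) = C + {x i₀} := by
    rw [coe_ofFn_sum, hC, Finset.sum_erase_add _ _ (Finset.mem_univ _)]
  have hx' : (↑(List.ofFn x') : Multiset 𝒯) = C + {x' i₀} := by
    have hCC : C = ∑ i ∈ Finset.univ.erase i₀, ({x' i} : Multiset 𝒯) :=
      Finset.sum_congr rfl (fun i hi => by rw [hsame i (Finset.ne_of_mem_erase hi)])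
    rw [coe_ofFn_sum, hCC, Finset.sum_erase_add _ (fun i => ({x' i} : Multiset 𝒯)) (Finset.mem_univ _)]
  have hsumP : ∀ (y : Fin n → 𝒯) (u : 𝒯), (↑(List.ofFn y) : Multiset 𝒯) = C + {u} →
      ∑ S ∈ 𝒪, P y S = (1 / (T : ℝ)) ^ d / ((d : ℝ) + 1) *
      ∑ h : Fin (d + 1) → 𝒯, (∑ j, if h j = u then (1 : ℝ) else 0) * F (∑ i, {h i}) := by
    intro y u hy
    rw [← symm_sum]
    simp_rw [hP]
    rw [Finset.sum_comm]
    have : ∀ z w : ℝ, z / ((d : ℝ) + 1) * (((d : ℝ) + 1) * w) = z * w := by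
      intro z w; field_simp
    rw [this, Finset.mul_sum]
    refine Finset.sum_congr rfl fun g _ => ?_
    rw [← Finset.mul_sum, Finset.sum_ite_eq, hy, coe_ofFn_sum, hF, add_assoc]
  rw [hsumP x _ hx, hsumP x' _ hx']
  set w : 𝒯 → ℝ := fun t => (if t = x i₀ then 1 else 0) - E * (if t = x' i₀ then 1 else 0) with hw
  set l : ℝ := 4 * a * T / b ^ 2 with hl
  have hlpos : 0 < l := by positivity
  have hwI : ∀ t, w t ∈ Set.Icc (-E) 1 := by
    intro t
    simp only [hw, Set.mem_Icc]
    split_ifs <;> constructor <;> linarith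
  have hwsum : ∑ t, w t = -a := by
    simp [hw, Finset.sum_sub_distrib, ha]
  have hH := hoeff_unif w (-E) 1 l hwI
  rw [hwsum, ← hT] at hH
  have hexpo : l * (-a / T) + l ^ 2 * (1 - -E) ^ 2 / 8 = -(2 * a ^ 2) / b ^ 2 := by
    have : (1 - -E) = b / T := by rw [hb]; field_simp; ring
    rw [this, hl]; field_simp; ring
  rw [hexpo] at hH
  have hpt : ∀ h : Fin (d + 1) → 𝒯,
      (∑ j, w (h j)) * F (∑ i, {h i}) ≤ (∏ j, Real.exp (l * w (h j))) / l := by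
    intro h
    rw [← Real.exp_sum, ← Finset.mul_sum, le_div_iff₀ hlpos]
    set Z := ∑ j, w (h j)
    have h1 := Real.add_one_le_exp (l * Z)
    have h2 := Real.exp_pos (l * Z)
    simp only [hF]
    split_ifs <;> nlinarith
  have hsum : ∑ h : Fin (d + 1) → 𝒯, (∑ j, w (h j)) * F (∑ i, {h i}) ≤
      ((T : ℝ) * Real.exp (-(2 * a ^ 2) / b ^ 2)) ^ (d + 1) / l := by
    refine (Finset.sum_le_sum fun h _ => hpt h).trans ?_
    rw [← Finset.sum_div, ← Fintype.sum_pow (fun t => Real.exp (l * w t))]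
    gcongr
  have hsplit : ∑ h : Fin (d + 1) → 𝒯, (∑ j, w (h j)) * F (∑ i, {h i}) =
      (∑ h : Fin (d + 1) → 𝒯, (∑ j, if h j = x i₀ then (1 : ℝ) else 0) * F (∑ i, {h i})) -
      E * ∑ h : Fin (d + 1) → 𝒯, (∑ j, if h j = x' i₀ then (1 : ℝ) else 0) * F (∑ i, {h i}) := by
    rw [Finset.mul_sum, ← Finset.sum_sub_distrib]
    refine Finset.sum_congr rfl fun h _ => ?_
    simp only [hw, Finset.sum_sub_distrib, ← Finset.mul_sum]
    ring
  rw [hsplit] at hsum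
  have hk : (0 : ℝ) ≤ (1 / (T : ℝ)) ^ d / ((d : ℝ) + 1) := by positivity
  have hfin := mul_le_mul_of_nonneg_left hsum hk
  have heq : (1 / (T : ℝ)) ^ d / ((d : ℝ) + 1) *
      (((T : ℝ) * Real.exp (-(2 * a ^ 2) / b ^ 2)) ^ (d + 1) / l) =
      (1 / ((d : ℝ) + 1)) * (b ^ 2 / (4 * a)) *
      Real.exp (-(2 * ((d : ℝ) + 1) * a ^ 2) / b ^ 2) := by
    rw [mul_pow, ← Real.exp_nat_mul]
    have : ((d + 1 : ℕ) : ℝ) * (-(2 * a ^ 2) / b ^ 2) = -(2 * ((d : ℝ) + 1) * a ^ 2) / b ^ 2 := by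
      push_cast; ring
    rw [this, hl]
    generalize Real.exp (-(2 * ((d : ℝ) + 1) * a ^ 2) / b ^ 2) = X
    rw [one_div, inv_pow]
    field_simp
    ring
  rw [heq] at hfin
  linarith
end

section
/- Let ε > 0, let (μ_x)_{x∈X} be a family of probability mass functions on a finite set Y admitting the mixture decomposition μ_x = (1−γ)·υ_x + γ·ω for some γ ∈ (0,1], probability mass functions υ_x, and a common blanket distribution ω with full support, and let A = S_{R,d} ∘ R^n be the algorithm that applies the local randomizer with output law μ_{x_i} independently to each of n inputs, draws d additional independent samples from ω, and outputs the multiset of the n+d results. Then for any two neighboring datasets D = (x_1,…,x_{n−1},x_n) and D′ = (x_1,…,x_{n−1},x_n′) with x_n ≠ x_n′, the hockey-stick divergence satisfies D_{e^ε}(A(D) ‖ A(D′)) ≤ Σ_{m=0}^{n−1} (1/(m+d+1)) · C(n−1,m) · γ^m · (1−γ)^{n−1−m} · E[ ( Σ_{i=1}^{m+d+1} L_i )₊ ], where L_1,…,L_{m+d+1} are i.i.d. copies of the privacy amplification random variable L_ε^{x_n,x_n′} = (μ_{x_n}(W) − e^ε·μ_{x_n′}(W))/ω(W) with W ∼ ω,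 and this upper bound equals (1/(γn)) · Σ_{m=1}^{n} (m/(m+d)) · C(n,m) · γ^m · (1−γ)^{n−m} · E[ ( Σ_{i=1}^{m+d} L_i )₊ ]. -/
def GG {Y : Type*} [Fintype Y] : List (Y → ℝ) → (Multiset Y → ℝ) → ℝ
  | [], φ => φ 0
  | ν :: L, φ => ∑ y, ν y * GG L (fun M => φ (y ::ₘ M))

theorem GG_cons {Y : Type*} [Fintype Y] (ν : Y → ℝ) (L : List (Y → ℝ)) (φ : Multiset Y → ℝ) :
    GG (ν :: L) φ = ∑ y, ν y * GG L (fun M => φ (y ::ₘ M)) := rfl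

theorem GG_perm {Y : Type*} [Fintype Y] {L L' : List (Y → ℝ)} (h : L.Perm L') :
    ∀ φ : Multiset Y → ℝ, GG L φ = GG L' φ := by
  induction h with
  | nil => intro φ; rfl
  | cons x _ ih => intro φ; simp only [GG, ih]
  | swap x y l =>
    intro φ
    simp only [GG, Finset.mul_sum]
    rw [Finset.sum_comm]
    refine Finset.sum_congr rfl fun a _ => Finset.sum_congr rfl fun b _ => ?_
    simp only [Multiset.cons_swap a b]
    ring
  | trans _ _ ih1 ih2 => intro φ; rw [ih1, ih2]

theorem GG_append {Y : Type*} [Fintype Y] (L L' : List (Y → ℝ)) :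
    ∀ φ : Multiset Y → ℝ, GG (L ++ L') φ = GG L (fun M => GG L' (fun M' => φ (M + M'))) := by
  induction L with
  | nil => intro φ; simp [GG]
  | cons a L ih => intro φ; simp only [List.cons_append, GG, ih, Multiset.cons_add]

theorem GG_ofFn {Y : Type*} [Fintype Y] : ∀ (k : ℕ) (ν : Fin k → Y → ℝ) (φ : Multiset Y → ℝ),
    GG (List.ofFn ν) φ = ∑ w : Fin k → Y, (∏ i, ν i (w i)) * φ (↑(List.ofFn w) : Multiset Y) := by
  intro k
  induction k with
  | zero => intro ν φ; simp [GG]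
  | succ k ih =>
    intro ν φ
    rw [List.ofFn_succ]
    simp only [GG, ih]
    rw [← (Fin.consEquiv (fun _ : Fin (k+1) => Y)).sum_comp, Fintype.sum_prod_type]
    refine Finset.sum_congr rfl fun a _ => ?_
    rw [Finset.mul_sum]
    refine Finset.sum_congr rfl fun b _ => ?_
    simp [Fin.consEquiv, Fin.prod_univ_succ, List.ofFn_succ, mul_assoc]

theorem ofFn_perm {α : Type*} {k : ℕ} (f : Fin (k+1) → α) (j : Fin (k+1)) :
    (List.ofFn f).Perm (f j :: List.ofFn (fun i => f (j.succAbove i))) := by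
  rw [← Multiset.coe_eq_coe, ← Multiset.cons_coe]
  have h : ∀ (m : ℕ) (g : Fin m → α),
      (↑(List.ofFn g) : Multiset α) = Multiset.map g Finset.univ.val := by
    intro m g
    rw [Fin.univ_val_map]
  rw [h, h, Fin.univ_succAbove k j]
  simp [Function.comp_def]

theorem GG_base {Y : Type*} [Fintype Y] (ω a : Y → ℝ) (hω0 : ∀ y, 0 < ω y) (d : ℕ)
    (φ : Multiset Y → ℝ) (h0 : ∀ M, 0 ≤ φ M) (h1 : ∀ M, φ M ≤ 1) :
    GG (a :: List.replicate d ω) φ ≤ 1 / ((d : ℝ) + 1) * ∑ w : Fin (d + 1) → Y,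
      (∏ i, ω (w i)) * max (∑ i, a (w i) / ω (w i)) 0 := by
  have key : ∀ j : Fin (d+1), GG (a :: List.replicate d ω) φ = ∑ w : Fin (d + 1) → Y,
      (∏ i, ω (w i)) * (a (w j) / ω (w j)) * φ (↑(List.ofFn w) : Multiset Y) := by
    intro j
    have hp := ofFn_perm (Function.update (fun _ : Fin (d+1) => ω) j a) j
    simp only [Function.update_self, ne_eq, Fin.succAbove_ne, not_false_eq_true,
      Function.update_of_ne, List.ofFn_const] at hp
    rw [← GG_perm hp, GG_ofFn]
    refine Finset.sum_congr rfl fun w _ => ?_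
    congr 1
    rw [Fin.prod_univ_succAbove _ j, Fin.prod_univ_succAbove _ j]
    simp only [Function.update_self, ne_eq, Fin.succAbove_ne, not_false_eq_true,
      Function.update_of_ne]
    have := (hω0 (w j)).ne'
    field_simp
  have hsum : ((d : ℝ) + 1) * GG (a :: List.replicate d ω) φ = ∑ w : Fin (d + 1) → Y,
      (∏ i, ω (w i)) * (∑ i, a (w i) / ω (w i)) * φ (↑(List.ofFn w) : Multiset Y) := by
    have : ∑ j : Fin (d+1), GG (a :: List.replicate d ω) φ
        = ((d : ℝ) + 1) * GG (a :: List.replicate d ω) φ := by simp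
    rw [← this, Finset.sum_congr rfl (fun j _ => key j), Finset.sum_comm]
    refine Finset.sum_congr rfl fun w _ => ?_
    rw [Finset.mul_sum, Finset.sum_mul]
  rw [one_div, ← div_eq_inv_mul, le_div_iff₀ (by positivity), mul_comm, hsum]
  refine Finset.sum_le_sum fun w _ => ?_
  rw [mul_assoc]
  refine mul_le_mul_of_nonneg_left ?_ (Finset.prod_nonneg fun i _ => (hω0 _).le)
  calc _ ≤ max (∑ i, a (w i) / ω (w i)) 0 * φ (↑(List.ofFn w) : Multiset Y) :=
        mul_le_mul_of_nonneg_right (le_max_left _ _) (h0 _)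
    _ ≤ _ := mul_le_of_le_one_right (le_max_right _ _) (h1 _)

def BB (γ : ℝ) (e : ℕ → ℝ) (N d : ℕ) : ℝ :=
  ∑ m ∈ Finset.range (N + 1), (N.choose m : ℝ) * (γ ^ m * (1 - γ) ^ (N - m) * e (m + d))

theorem BB_succ (γ : ℝ) (e : ℕ → ℝ) (N d : ℕ) :
    BB γ e (N + 1) d = (1 - γ) * BB γ e N d + γ * BB γ e N (d + 1) := by
  unfold BB
  rw [Finset.sum_choose_succ_mul (fun i j => γ ^ i * (1 - γ) ^ j * e (i + d)),
    Finset.mul_sum, Finset.mul_sum]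
  refine congrArg₂ (· + ·) ?_ ?_ <;> refine Finset.sum_congr rfl fun i hi => ?_
  · have : N + 1 - i = (N - i) + 1 := by
      have := Finset.mem_range.1 hi
      omega
    rw [this]; ring
  · rw [show i + 1 + d = i + (d + 1) by ring]; ring

theorem GG_bound {X Y : Type*} [Fintype Y] (γ : ℝ) (hγ0 : 0 < γ) (hγ1 : γ ≤ 1)
    (μ υ : X → Y → ℝ) (ω a : Y → ℝ)
    (hυ0 : ∀ x y, 0 ≤ υ x y) (hω0 : ∀ y, 0 < ω y)
    (hυ1 : ∀ x, ∑ y, υ x y = 1)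
    (hdecomp : ∀ x y, μ x y = (1 - γ) * υ x y + γ * ω y) (e : ℕ → ℝ)
    (he : ∀ d, e d = 1 / ((d : ℝ) + 1) * ∑ w : Fin (d + 1) → Y,
      (∏ i, ω (w i)) * max (∑ i, a (w i) / ω (w i)) 0) (l : List X) :
    ∀ (d : ℕ) (φ : Multiset Y → ℝ) (_ : ∀ M, 0 ≤ φ M) (_ : ∀ M, φ M ≤ 1),
    GG (a :: (l.map μ ++ List.replicate d ω)) φ ≤ BB γ e l.length d := by
  induction l with
  | nil =>
    intro d φ h0 h1
    have := GG_base ω a hω0 d φ h0 h1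
    rw [← he] at this
    simpa [BB] using this
  | cons x l ih =>
    intro d φ h0 h1
    have e1 : GG (a :: ((x :: l).map μ ++ List.replicate d ω)) φ
        = GG (μ x :: a :: (l.map μ ++ List.replicate d ω)) φ :=
      GG_perm (List.Perm.swap _ _ _) φ
    have e2 : GG (μ x :: a :: (l.map μ ++ List.replicate d ω)) φ
        = (1 - γ) * GG (υ x :: a :: (l.map μ ++ List.replicate d ω)) φ
          + γ * GG (ω :: a :: (l.map μ ++ List.replicate d ω)) φ := by
      rw [GG_cons (μ x), GG_cons (υ x), GG_cons ω, Finset.mul_sum, Finset.mul_sum, ← Finset.sum_add_distrib]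
      refine Finset.sum_congr rfl fun y _ => ?_
      rw [hdecomp]; ring
    have e3 : GG (ω :: a :: (l.map μ ++ List.replicate d ω)) φ
        = GG (a :: (l.map μ ++ List.replicate (d + 1) ω)) φ := by
      apply GG_perm
      refine (List.Perm.swap _ _ _).trans (List.Perm.cons _ ?_)
      rw [List.replicate_succ]
      exact List.perm_middle.symm
    have e4 : GG (υ x :: a :: (l.map μ ++ List.replicate d ω)) φ ≤ BB γ e l.length d := by
      rw [GG]
      calc _ ≤ ∑ y, υ x y * BB γ e l.length d :=
            Finset.sum_le_sum fun y _ => mul_le_mul_of_nonneg_left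
              (ih d _ (fun M => h0 _) (fun M => h1 _)) (hυ0 x y)
        _ = _ := by rw [← Finset.sum_mul, hυ1, one_mul]
    rw [e1, e2, e3, List.length_cons, BB_succ]
    exact add_le_add (mul_le_mul_of_nonneg_left e4 (by linarith))
      (mul_le_mul_of_nonneg_left (ih _ _ h0 h1) hγ0.le)

theorem sum_sym {Y : Type*} [Fintype Y] [DecidableEq Y] (n d : ℕ) (A : (Fin n → Y) → ℝ)
    (B : (Fin d → Y) → ℝ) (φ : Multiset Y → ℝ) :
    ∑ S : Sym Y (n + d), φ S.toMultiset * (∑ f : Fin n → Y, ∑ g : Fin d → Y,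
      A f * B g *
        (if (↑(List.ofFn f) : Multiset Y) + (↑(List.ofFn g) : Multiset Y) = S.toMultiset
         then 1 else 0)) = ∑ f : Fin n → Y, A f * ∑ g : Fin d → Y, B g *
          φ ((↑(List.ofFn f) : Multiset Y) + (↑(List.ofFn g) : Multiset Y)) := by
  simp only [Finset.mul_sum]
  rw [Finset.sum_comm]
  refine Finset.sum_congr rfl fun f _ => ?_
  rw [Finset.sum_comm]
  refine Finset.sum_congr rfl fun g _ => ?_
  have hc : ((↑(List.ofFn f) : Multiset Y) + (↑(List.ofFn g) : Multiset Y)).card = n + d := by simp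
  refine (Fintype.sum_eq_single
    (Sym.mk ((↑(List.ofFn f) : Multiset Y) + (↑(List.ofFn g) : Multiset Y)) hc)
    ?_).trans ?_
  · intro S hS
    rw [if_neg]
    · ring
    · intro h
      exact hS (Subtype.ext h.symm)
  · simp [Sym.toMultiset]; ring

/-- Bounding the hockey-stick divergence between outputs of `A = S_{R,d} ∘ R^n` (local
randomizers with output laws `μ_x = (1-γ)·υ_x + γ·ω` applied independently to each input,
plus `d` dummies drawn from the blanket `ω`, output the multiset of the `n+d` results) on
neighboring datasets, in terms of i.i.d. copies of the privacy amplification variable. -/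
theorem stmt5 {X Y : Type*} [Fintype Y] [DecidableEq Y] [Nonempty X]
    (ε : ℝ) (hε : 0 < ε)
    (n : ℕ) (hn : 1 ≤ n) (d : ℕ)
    (γ : ℝ) (hγ0 : 0 < γ) (hγ1 : γ ≤ 1)
    (μ υ : X → Y → ℝ) (ω : Y → ℝ)
    (hμ0 : ∀ x y, 0 ≤ μ x y) (hυ0 : ∀ x y, 0 ≤ υ x y) (hω0 : ∀ y, 0 < ω y)
    (hμ1 : ∀ x, ∑ y, μ x y = 1) (hυ1 : ∀ x, ∑ y, υ x y = 1) (hω1 : ∑ y, ω y = 1)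
    (hdecomp : ∀ x y, μ x y = (1 - γ) * υ x y + γ * ω y)
    (xs xs' : Fin n → X) (i₀ : Fin n) (hneq : xs i₀ ≠ xs' i₀)
    (hsame : ∀ i, i ≠ i₀ → xs i = xs' i)
    (P : (Fin n → X) → Multiset Y → ℝ)
    (hP : ∀ x S, P x S = ∑ f : Fin n → Y, ∑ g : Fin d → Y,
      (∏ i, μ (x i) (f i)) * (∏ j, ω (g j)) *
        (if (↑(List.ofFn f) : Multiset Y) + (↑(List.ofFn g) : Multiset Y) = S
         then 1 else 0))
    (E : ℕ → ℝ)
    (hE : ∀ k, E k = ∑ w : Fin k → Y,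
      (∏ i, ω (w i)) *
        max (∑ i, (μ (xs i₀) (w i) - Real.exp ε * μ (xs' i₀) (w i)) / ω (w i)) 0) :
    (∑ S : Sym Y (n + d),
        max (P xs S.toMultiset - Real.exp ε * P xs' S.toMultiset) 0
      ≤ ∑ m ∈ Finset.range n,
          (1 / ((m : ℝ) + (d : ℝ) + 1)) * (((n - 1).choose m : ℕ) : ℝ) * γ ^ m *
            (1 - γ) ^ (n - 1 - m) * E (m + d + 1))
    ∧ (∑ m ∈ Finset.range n,
          (1 / ((m : ℝ) + (d : ℝ) + 1)) * (((n - 1).choose m : ℕ) : ℝ) * γ ^ m *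
            (1 - γ) ^ (n - 1 - m) * E (m + d + 1)
      = (1 / (γ * (n : ℝ))) * ∑ m ∈ Finset.Icc 1 n,
          ((m : ℝ) / ((m : ℝ) + (d : ℝ))) * ((n.choose m : ℕ) : ℝ) * γ ^ m *
            (1 - γ) ^ (n - m) * E (m + d)) := by
  constructor
  swap
  · rw [Finset.mul_sum, ← Finset.Ico_add_one_right_eq_Icc, Finset.sum_Ico_eq_sum_range]
    refine Finset.sum_congr rfl fun m hm => ?_
    obtain ⟨N, rfl⟩ : ∃ N, n = N + 1 := ⟨n - 1, by omega⟩
    have h := Nat.add_one_mul_choose_eq N m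
    have h' : ((N : ℝ) + 1) * (N.choose m : ℝ) = ((N + 1).choose (m + 1) : ℝ) * ((m : ℝ) + 1) := by
      exact_mod_cast h
    rw [show 1 + m = m + 1 by ring, show N + 1 - (m + 1) = N - m by omega,
      show N + 1 - 1 - m = N - m by omega, show m + 1 + d = m + d + 1 by ring, Nat.add_sub_cancel]
    have hN : ((N : ℝ) + 1) ≠ 0 := by positivity
    have hM : ((m : ℝ) + d + 1) ≠ 0 := by positivity
    have hc : (N.choose m : ℝ) = ((N + 1).choose (m + 1) : ℝ) * ((m : ℝ) + 1) / ((N : ℝ) + 1) := by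
      rw [eq_div_iff hN]; linarith
    rw [hc]
    push_cast
    rw [show (m : ℝ) + 1 + d = m + d + 1 by ring]
    field_simp
    ring
  · obtain ⟨N, rfl⟩ : ∃ N, n = N + 1 := ⟨n - 1, by omega⟩
    set c := Real.exp ε
    set φ : Multiset Y → ℝ := fun M => if 0 < P xs M - c * P xs' M then 1 else 0 with hφ
    have hmax : ∀ M, max (P xs M - c * P xs' M) 0 = φ M * P xs M - c * (φ M * P xs' M) := by
      intro M
      simp only [hφ]
      split_ifs with h
      · rw [max_eq_left h.le]; ring
      · rw [max_eq_right (not_lt.1 h)]; ring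
    set r : List X := List.ofFn (fun i => xs (i₀.succAbove i)) with hr
    have hG : ∀ x : Fin (N + 1) → X, (∀ i, i ≠ i₀ → xs i = x i) →
        ∑ S : Sym Y (N + 1 + d), φ S.toMultiset * P x S.toMultiset
        = GG (μ (x i₀) :: (r.map μ ++ List.replicate d ω)) φ := by
      intro x hx
      simp only [hP]
      rw [sum_sym (N + 1) d (fun f => ∏ i, μ (x i) (f i)) (fun g => ∏ j, ω (g j)) φ]
      have hp := ofFn_perm (fun i => μ (x i)) i₀
      have hrr : List.ofFn (fun i => μ (x (i₀.succAbove i))) = r.map μ := by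
        rw [hr, List.map_ofFn]
        congr 1
        funext i
        simp [hx _ (Fin.succAbove_ne i₀ i)]
      rw [hrr] at hp
      have hp2 := hp.append_right (List.replicate d ω)
      rw [List.cons_append] at hp2
      rw [← GG_perm hp2, GG_append, GG_ofFn]
      refine Finset.sum_congr rfl fun f _ => ?_
      rw [← List.ofFn_const, GG_ofFn]
    simp only [hmax]
    rw [Finset.sum_sub_distrib, ← Finset.mul_sum, hG xs (fun _ _ => rfl), hG xs' hsame]
    set a : Y → ℝ := fun y => μ (xs i₀) y - c * μ (xs' i₀) y with ha
    have hlin : GG (μ (xs i₀) :: (r.map μ ++ List.replicate d ω)) φ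
        - c * GG (μ (xs' i₀) :: (r.map μ ++ List.replicate d ω)) φ
        = GG (a :: (r.map μ ++ List.replicate d ω)) φ := by
      rw [GG_cons (μ (xs i₀)), GG_cons (μ (xs' i₀)), GG_cons a, Finset.mul_sum, ← Finset.sum_sub_distrib]
      refine Finset.sum_congr rfl fun y _ => ?_
      simp only [ha]; ring
    rw [hlin]
    refine (GG_bound γ hγ0 hγ1 μ υ ω a hυ0 hω0 hυ1 hdecomp
      (fun k => 1 / ((k : ℝ) + 1) * E (k + 1)) (fun k => by simp only [hE, ha]) r d φ ?_ ?_).trans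
      (le_of_eq ?_)
    · intro M; simp only [hφ]; split_ifs <;> norm_num
    · intro M; simp only [hφ]; split_ifs <;> norm_num
    · rw [show r.length = N by simp [hr], BB]
      refine Finset.sum_congr rfl fun m _ => ?_
      rw [Nat.add_sub_cancel]
      push_cast
      ring
end

section
/- Let μ and ω be probability mass functions on a finite set Y with ω(y) > 0 for all y, let N ≥ 1, and let X_1,…,X_N be independent random variables with X_j ∼ ω for all j ≠ j₀ and X_{j₀} ∼ μ for some fixed index j₀. Then for every multiset S = {y_1,…,y_N} of N elements of Y, P[{X_1,…,X_N} = S] = P[{W_1,…,W_N} = S] · (1/N) · Σ_{i=1}^{N} μ(y_i)/ω(y_i), where W_1,…,W_N are i.i.d. with law ω, {X_1,…,X_N} denotes the random multiset of the values, and the sum runs over the elements of S counted with multiplicity. -/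
/-- Multiset probability factorization: if `X_{j₀} ∼ μ` and `X_j ∼ ω` for `j ≠ j₀` are
independent, then for every multiset `S` of size `N`,
`P[{X_1,…,X_N} = S] = P[{W_1,…,W_N} = S] · (1/N) · Σ_{y ∈ S} μ(y)/ω(y)`,
where `W_1,…,W_N` are i.i.d. with law `ω` and the sum counts multiplicity. -/
theorem stmt6 {Y : Type*} [Fintype Y] [DecidableEq Y]
    (N : ℕ) (hN : 1 ≤ N) (j₀ : Fin N)
    (μ ω : Y → ℝ)
    (hμ0 : ∀ y, 0 ≤ μ y) (hω0 : ∀ y, 0 < ω y)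
    (hμ1 : ∑ y, μ y = 1) (hω1 : ∑ y, ω y = 1)
    (S : Multiset Y) (hS : Multiset.card S = N) :
    (∑ f : Fin N → Y,
        (if (↑(List.ofFn f) : Multiset Y) = S then 1 else 0) *
          ∏ j, (if j = j₀ then μ (f j) else ω (f j)))
      = (∑ f : Fin N → Y,
          (if (↑(List.ofFn f) : Multiset Y) = S then 1 else 0) * ∏ j, ω (f j))
        * ((1 : ℝ) / (N : ℝ)) * ((S.map (fun y => μ y / ω y)).sum) := by
  classical
  have hN' : (N : ℝ) ≠ 0 := by
    have : N ≠ 0 := by omega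
    exact_mod_cast this
  set A : Fin N → ℝ := fun j => ∑ f : Fin N → Y,
    (if (↑(List.ofFn f) : Multiset Y) = S then 1 else 0) *
      ((∏ i, ω (f i)) * (μ (f j) / ω (f j))) with hA
  have h1 : (∑ f : Fin N → Y,
        (if (↑(List.ofFn f) : Multiset Y) = S then 1 else 0) *
          ∏ j, (if j = j₀ then μ (f j) else ω (f j))) = A j₀ := by
    refine Finset.sum_congr rfl fun f _ => ?_
    congr 1
    rw [← Finset.mul_prod_erase Finset.univ _ (Finset.mem_univ j₀),
      ← Finset.mul_prod_erase Finset.univ (fun i => ω (f i)) (Finset.mem_univ j₀)]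
    have : ∏ x ∈ Finset.univ.erase j₀, (if x = j₀ then μ (f x) else ω (f x))
        = ∏ x ∈ Finset.univ.erase j₀, ω (f x) := by
      refine Finset.prod_congr rfl fun x hx => ?_
      rw [if_neg (Finset.ne_of_mem_erase hx)]
    rw [this, if_pos rfl]
    have := (hω0 (f j₀)).ne'
    field_simp
  have h2 : ∀ j, A j = A j₀ := by
    intro j
    refine Fintype.sum_equiv (Equiv.arrowCongr (Equiv.swap j j₀) (Equiv.refl Y)) _ _ fun f => ?_
    have e : (Equiv.arrowCongr (Equiv.swap j j₀) (Equiv.refl Y)) f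
        = f ∘ (Equiv.swap j j₀) := by
      ext i; simp [Equiv.arrowCongr]
    rw [e]
    have p : (↑(List.ofFn (f ∘ (Equiv.swap j j₀))) : Multiset Y) = ↑(List.ofFn f) := 
      Multiset.coe_eq_coe.2 (Equiv.Perm.ofFn_comp_perm (Equiv.swap j j₀) f)
    have q : ∏ i, ω ((f ∘ (Equiv.swap j j₀)) i) = ∏ i, ω (f i) :=
      Equiv.prod_comp (Equiv.swap j j₀) (fun i => ω (f i))
    rw [p, q]
    simp
  have h3 : ∑ j, A j = (∑ f : Fin N → Y,
          (if (↑(List.ofFn f) : Multiset Y) = S then 1 else 0) * ∏ j, ω (f j))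
        * ((S.map (fun y => μ y / ω y)).sum) := by
    rw [hA, Finset.sum_comm, Finset.sum_mul]
    refine Finset.sum_congr rfl fun f _ => ?_
    rw [← Finset.mul_sum, ← Finset.mul_sum, mul_assoc]
    split_ifs with h
    · rw [← h]
      simp [List.map_ofFn, List.sum_ofFn]
    · simp
  have h4 : ∑ j, A j = N * A j₀ := by
    rw [Finset.sum_congr rfl fun j _ => h2 j]; simp
  rw [h1]
  rw [h4] at h3
  rw [mul_right_comm, ← h3]
  field_simp
end

section
/- Let ε ≥ 0, let μ, μ′ and ω be probability mass functions on a finite set Y with ω(y) > 0 for all y, and let N ≥ 1. Let W_1,…,W_{N−1} be i.i.d. with law ω, and let Y₀ ∼ μ and Y₀′ ∼ μ′ be independent of the W_i's. Then the hockey-stick divergence between the laws of the random multisets {W_1,…,W_{N−1}, Y₀} and {W_1,…,W_{N−1}, Y₀′} satisfies D_{e^ε}( {W_1,…,W_{N−1},Y₀} ‖ {W_1,…,W_{N−1},Y₀′} ) = E[ ( (1/N) · Σ_{i=1}^{N} L_i )₊ ], where L_1,…,L_N are i.i.d. copies of the privacy amplification random variable L = (μ(W) − e^ε·μ′(W))/ω(W)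 with W ∼ ω. -/
theorem stmt7_aux {Y : Type*} [Fintype Y] [DecidableEq Y] (n : ℕ) (ν ω : Y → ℝ)
    (hω0 : ∀ y, 0 < ω y) (S : Multiset Y) (i : Fin (n + 1)) :
    (∑ w : Fin n → Y, ∑ y : Y, (∏ i, ω (w i)) * ν y *
        (if (↑(List.ofFn w) : Multiset Y) + ({y} : Multiset Y) = S then 1 else 0))
    = ∑ w : Fin (n + 1) → Y, (∏ i, ω (w i)) * (ν (w i) / ω (w i)) *
        (if (↑(List.ofFn w) : Multiset Y) = S then 1 else 0) := by
  rw [← (Fin.insertNthEquiv (fun _ => Y) i).sum_comp, Fintype.sum_prod_type, Finset.sum_comm]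
  refine Finset.sum_congr rfl fun y _ => Finset.sum_congr rfl fun w _ => ?_
  have h1 : (↑(List.ofFn (i.insertNth (α := fun _ => Y) y w)) : Multiset Y)
      = (↑(List.ofFn w) : Multiset Y) + {y} := by
    have h := fun (m : ℕ) (v : Fin m → Y) => (Fin.univ_val_map v).symm
    rw [h, h, Fin.univ_succAbove n i]
    simp [Function.comp_def]
    rw [← Multiset.cons_coe, ← Multiset.singleton_add, add_comm]
  have h2 : (Fin.insertNthEquiv (fun _ => Y) i) (y, w) = i.insertNth (α := fun _ => Y) y w := rfl
  rw [h2, h1, Fin.prod_univ_succAbove _ i]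
  simp only [Fin.insertNth_apply_same, Fin.insertNth_apply_succAbove]
  have := (hω0 y).ne'
  field_simp

/-- The hockey-stick divergence between the laws of the multisets
`{W_1,…,W_{N-1}, Y₀}` (with `W_i` i.i.d. `ω` and `Y₀ ∼ μ`) and `{W_1,…,W_{N-1}, Y₀'}`
(with `Y₀' ∼ μ'`) equals `E[((1/N)·Σ_{i=1}^N L_i)₊]` for i.i.d. copies `L_i` of the
privacy amplification variable `L = (μ(W) - e^ε·μ'(W))/ω(W)`, `W ∼ ω`. -/
theorem stmt7 {Y : Type*} [Fintype Y] [DecidableEq Y]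
    (ε : ℝ) (hε : 0 ≤ ε)
    (N : ℕ) (hN : 1 ≤ N)
    (μ μ' ω : Y → ℝ)
    (hμ0 : ∀ y, 0 ≤ μ y) (hμ'0 : ∀ y, 0 ≤ μ' y) (hω0 : ∀ y, 0 < ω y)
    (hμ1 : ∑ y, μ y = 1) (hμ'1 : ∑ y, μ' y = 1) (hω1 : ∑ y, ω y = 1)
    (Q : (Y → ℝ) → Multiset Y → ℝ)
    (hQ : ∀ ν S, Q ν S = ∑ w : Fin (N - 1) → Y, ∑ y : Y,
      (∏ i, ω (w i)) * ν y *
        (if (↑(List.ofFn w) : Multiset Y) + ({y} : Multiset Y) = S then 1 else 0)) :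
    ∑ S : Sym Y N, max (Q μ S.toMultiset - Real.exp ε * Q μ' S.toMultiset) 0
      = ∑ w : Fin N → Y, (∏ i, ω (w i)) *
          max ((1 / (N : ℝ)) * ∑ i, (μ (w i) - Real.exp ε * μ' (w i)) / ω (w i)) 0 := by
  obtain ⟨n, rfl⟩ : ∃ n, N = n + 1 := ⟨N - 1, by omega⟩
  set f : Y → ℝ := fun y => (μ y - Real.exp ε * μ' y) / ω y with hf
  set a : Multiset Y → ℝ := fun S => (1 / ((n + 1 : ℕ) : ℝ)) * (S.map f).sum with ha
  have haw : ∀ w : Fin (n + 1) → Y, (1 / ((n + 1 : ℕ) : ℝ)) * ∑ i, f (w i)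
      = a (↑(List.ofFn w) : Multiset Y) := by
    intro w
    simp only [ha, Multiset.map_coe, List.map_ofFn, Multiset.sum_coe, List.sum_ofFn, Function.comp_def]
  have hD : ∀ S : Multiset Y, Q μ S - Real.exp ε * Q μ' S
      = a S * ∑ w : Fin (n + 1) → Y, (∏ i, ω (w i)) *
        (if (↑(List.ofFn w) : Multiset Y) = S then 1 else 0) := by
    intro S
    have hi : ∀ i : Fin (n + 1), Q μ S - Real.exp ε * Q μ' S
        = ∑ w : Fin (n + 1) → Y, (∏ i, ω (w i)) * f (w i) *
        (if (↑(List.ofFn w) : Multiset Y) = S then 1 else 0) := by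
      intro i
      have e1 := (hQ μ S).trans (stmt7_aux n μ ω hω0 S i)
      have e2 := (hQ μ' S).trans (stmt7_aux n μ' ω hω0 S i)
      rw [e1, e2, Finset.mul_sum, ← Finset.sum_sub_distrib]
      refine Finset.sum_congr rfl fun w _ => ?_
      simp only [hf]
      ring
    have hN0 : ((n + 1 : ℕ) : ℝ) ≠ 0 := by positivity
    have hs : ((n + 1 : ℕ) : ℝ) * (Q μ S - Real.exp ε * Q μ' S)
        = ∑ w : Fin (n + 1) → Y, (∏ i, ω (w i)) * (∑ i, f (w i)) *
        (if (↑(List.ofFn w) : Multiset Y) = S then 1 else 0) := by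
      have : ((n + 1 : ℕ) : ℝ) * (Q μ S - Real.exp ε * Q μ' S)
        = ∑ i : Fin (n + 1), (Q μ S - Real.exp ε * Q μ' S) := by
        rw [Finset.sum_const, Finset.card_univ, Fintype.card_fin, nsmul_eq_mul]
      rw [this, Finset.sum_congr rfl fun i _ => hi i, Finset.sum_comm]
      refine Finset.sum_congr rfl fun w _ => ?_
      rw [Finset.mul_sum, Finset.sum_mul]
    apply mul_left_cancel₀ hN0
    rw [hs, Finset.mul_sum, Finset.mul_sum]
    refine Finset.sum_congr rfl fun w _ => ?_
    split_ifs with h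
    · rw [← h, ← haw]
      field_simp
    · simp
  have hP : ∀ w : Fin (n + 1) → Y, 0 ≤ ∏ i, ω (w i) :=
    fun w => Finset.prod_nonneg fun i _ => (hω0 _).le
  have hM : ∀ S : Multiset Y, max (Q μ S - Real.exp ε * Q μ' S) 0
      = ∑ w : Fin (n + 1) → Y, (∏ i, ω (w i)) * max (a (↑(List.ofFn w) : Multiset Y)) 0 *
        (if (↑(List.ofFn w) : Multiset Y) = S then 1 else 0) := by
    intro S
    have hnn : 0 ≤ ∑ w : Fin (n + 1) → Y, (∏ i, ω (w i)) *
        (if (↑(List.ofFn w) : Multiset Y) = S then (1 : ℝ) else 0) :=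
      Finset.sum_nonneg fun w _ => mul_nonneg (hP w) (by split_ifs <;> norm_num)
    rw [hD]
    have := max_mul_of_nonneg (a S) 0 hnn
    rw [zero_mul] at this
    rw [← this, Finset.mul_sum]
    refine Finset.sum_congr rfl fun w _ => ?_
    split_ifs with h
    · rw [← h]; ring
    · simp
  rw [Finset.sum_congr rfl fun S _ => hM _, Finset.sum_comm]
  refine Finset.sum_congr rfl fun w _ => ?_
  rw [← Finset.mul_sum, haw]
  have h1 : ∑ S : Sym Y (n + 1), (if (↑(List.ofFn w) : Multiset Y) = S.toMultiset then (1 : ℝ) else 0)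
      = 1 := by
    have hc : Multiset.card (↑(List.ofFn w) : Multiset Y) = n + 1 := by simp
    refine (Finset.sum_eq_single (⟨(↑(List.ofFn w) : Multiset Y), hc⟩ : Sym Y (n + 1)) ?_ ?_).trans ?_
    · intro S _ hS
      refine if_neg fun h => hS (Subtype.ext h.symm)
    · intro h
      exact absurd (Finset.mem_univ (α := Sym Y (n + 1)) _) h
    · exact if_pos rfl
  rw [h1, mul_one]
end

section
/- Let (μ_x)_{x∈X} be a nonempty family of probability mass functions on a finite set Y such that for all x, x′ ∈ X and all y ∈ Y, μ_x(y) ≤ e^{ε₀}·μ_{x′}(y) (i.e., the associated local randomizer is ε₀-differentially private). Set γ = Σ_{y∈Y} inf_{x∈X} μ_x(y), assume γ > 0, and define the blanket distribution ω(y) = inf_{x∈X} μ_x(y)/γ. Then for any ε ≥ 0, any x, x′ ∈ X, and every y ∈ Y with ω(y) > 0, the privacy amplification quantity L(y) = (μ_x(y) − e^ε·μ_{x′}(y))/ω(y) satisfies γ·e^{−ε₀}·(1 − e^{ε+2ε₀}) ≤ L(y) ≤ γ·e^{ε₀}·(1 − e^{ε−2ε₀}). -/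
/-- Bounds on the privacy amplification quantity for an `ε₀`-DP local randomizer with
total variation similarity `γ = Σ_y inf_x μ_x(y)` and blanket `ω(y) = inf_x μ_x(y)/γ`:
for all `y` with `ω(y) > 0`,
`γ·e^{-ε₀}·(1 - e^{ε+2ε₀}) ≤ (μ_x(y) - e^ε·μ_{x'}(y))/ω(y) ≤ γ·e^{ε₀}·(1 - e^{ε-2ε₀})`. -/
theorem stmt12 {X Y : Type*} [Fintype Y] [Nonempty X]
    (ε₀ : ℝ) (μ : X → Y → ℝ)
    (hμ0 : ∀ x y, 0 ≤ μ x y) (hμ1 : ∀ x, ∑ y, μ x y = 1)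
    (hdp : ∀ x x' y, μ x y ≤ Real.exp ε₀ * μ x' y)
    (γ : ℝ) (hγ : γ = ∑ y, ⨅ x, μ x y) (hγ0 : 0 < γ)
    (ω : Y → ℝ) (hω : ∀ y, ω y = (⨅ x, μ x y) / γ)
    (ε : ℝ) (hε : 0 ≤ ε) (x x' : X) (y : Y) (hωy : 0 < ω y) :
    γ * Real.exp (-ε₀) * (1 - Real.exp (ε + 2 * ε₀))
        ≤ (μ x y - Real.exp ε * μ x' y) / ω y
      ∧ (μ x y - Real.exp ε * μ x' y) / ω y
        ≤ γ * Real.exp ε₀ * (1 - Real.exp (ε - 2 * ε₀)) := by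
  have hm : 0 < ⨅ x, μ x y := by
    have h := hωy
    rw [hω] at h
    by_contra hc
    exact absurd h (not_lt.mpr (div_nonpos_of_nonpos_of_nonneg (not_lt.mp hc) hγ0.le))
  have hlow : ∀ z, (⨅ x, μ x y) ≤ μ z y := fun z =>
    ciInf_le ⟨0, by rintro _ ⟨w, rfl⟩; exact hμ0 w y⟩ z
  have hup : ∀ z, μ z y ≤ Real.exp ε₀ * ⨅ x, μ x y := by
    intro z
    have h : μ z y / Real.exp ε₀ ≤ ⨅ x, μ x y := by
      refine le_ciInf fun w => ?_
      rw [div_le_iff₀ (Real.exp_pos _), mul_comm]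
      exact hdp z w y
    rwa [div_le_iff₀ (Real.exp_pos _), mul_comm] at h
  rw [hω]
  generalize (⨅ x, μ x y) = m at *
  have ha1 := hlow x
  have hb1 := hlow x'
  have ha2 := hup x
  have hb2 := hup x'
  have hE : 1 ≤ Real.exp ε₀ := by
    by_contra hc
    have : Real.exp ε₀ * m < 1 * m := mul_lt_mul_of_pos_right (not_le.mp hc) hm
    linarith
  have hI : Real.exp (-ε₀) ≤ 1 := by
    rw [Real.exp_neg]; exact inv_le_one_of_one_le₀ hE
  have hId : Real.exp (-ε₀) * m ≤ m := by nlinarith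
  have hpe := Real.exp_pos ε
  have e1 : Real.exp (-ε₀) * (1 - Real.exp (ε + 2 * ε₀))
      = Real.exp (-ε₀) - Real.exp ε * Real.exp ε₀ := by
    rw [mul_sub, mul_one, ← Real.exp_add, ← Real.exp_add]; ring_nf
  have e2 : Real.exp ε₀ * (1 - Real.exp (ε - 2 * ε₀))
      = Real.exp ε₀ - Real.exp ε * Real.exp (-ε₀) := by
    rw [mul_sub, mul_one, ← Real.exp_add, ← Real.exp_add]; ring_nf
  have e3 : (μ x y - Real.exp ε * μ x' y) / (m / γ)
      = γ * ((μ x y - Real.exp ε * μ x' y) / m) := by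
    field_simp
  rw [mul_assoc, mul_assoc, e1, e2, e3]
  constructor
  · refine mul_le_mul_of_nonneg_left ?_ hγ0.le
    rw [le_div_iff₀ hm]
    have := mul_le_mul_of_nonneg_left hb2 hpe.le
    linarith
  · refine mul_le_mul_of_nonneg_left ?_ hγ0.le
    rw [div_le_iff₀ hm]
    have := mul_le_mul_of_nonneg_left (hId.trans hb1) hpe.le
    linarith
end

section
/- Let (μ_x)_{x∈X} be a nonempty family of probability mass functions on a finite set Y such that for all x, x′ ∈ X and all y ∈ Y, μ_x(y) ≤ e^{ε₀}·μ_{x′}(y). Set γ = Σ_{y∈Y} inf_{x∈X} μ_x(y), assume γ > 0, define ω(y) = inf_{x∈X} μ_x(y)/γ, and for ε ≥ 0 and x, x′ ∈ X let L = (μ_x(W) − e^ε·μ_{x′}(W))/ω(W) with W ∼ ω. Then E[L²] ≤ γ·e^{ε₀}·(e^{2ε} + 1) − 2·γ²·e^{ε−2ε₀}. -/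
/-- Second-moment bound on the privacy amplification variable for an `ε₀`-DP local
randomizer with total variation similarity `γ` and blanket distribution `ω`:
`E[L²] ≤ γ·e^{ε₀}·(e^{2ε} + 1) - 2γ²·e^{ε-2ε₀}`. -/
theorem stmt13 {X Y : Type*} [Fintype Y] [Nonempty X]
    (ε₀ : ℝ) (μ : X → Y → ℝ)
    (hμ0 : ∀ x y, 0 ≤ μ x y) (hμ1 : ∀ x, ∑ y, μ x y = 1)
    (hdp : ∀ x x' y, μ x y ≤ Real.exp ε₀ * μ x' y)
    (γ : ℝ) (hγ : γ = ∑ y, ⨅ x, μ x y) (hγ0 : 0 < γ)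
    (ω : Y → ℝ) (hω : ∀ y, ω y = (⨅ x, μ x y) / γ)
    (ε : ℝ) (hε : 0 ≤ ε) (x x' : X) :
    ∑ y, ω y * ((μ x y - Real.exp ε * μ x' y) / ω y) ^ 2
      ≤ γ * Real.exp ε₀ * (Real.exp (2 * ε) + 1) - 2 * γ ^ 2 * Real.exp (ε - 2 * ε₀) := by
  have hbdd : ∀ y, BddBelow (Set.range fun x => μ x y) := fun y =>
    ⟨0, by rintro _ ⟨z, rfl⟩; exact hμ0 z y⟩
  have hle : ∀ z y, (⨅ x, μ x y) ≤ μ z y := fun z y => ciInf_le (hbdd y) z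
  have hm0 : ∀ y, 0 ≤ ⨅ x, μ x y := fun y => le_ciInf fun z => hμ0 z y
  have hE : 0 < Real.exp ε₀ := Real.exp_pos _
  have hge : ∀ z y, μ z y ≤ Real.exp ε₀ * ⨅ x, μ x y := by
    intro z y
    have : μ z y / Real.exp ε₀ ≤ ⨅ x, μ x y := le_ciInf fun w => by
      rw [div_le_iff₀ hE, mul_comm]; exact hdp z w y
    rw [div_le_iff₀ hE, mul_comm] at this
    exact this
  have hE1 : 1 ≤ Real.exp ε₀ := by
    have h : ∑ y, μ x y ≤ ∑ y, Real.exp ε₀ * μ x y := Finset.sum_le_sum fun y _ => hdp x x y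
    rw [← Finset.mul_sum, hμ1] at h
    linarith
  have he0 : 0 ≤ ε₀ := Real.one_le_exp_iff.mp hE1
  have key : ∀ y, ω y * ((μ x y - Real.exp ε * μ x' y) / ω y) ^ 2 ≤
      γ * Real.exp ε₀ * μ x y + γ * Real.exp ε₀ * Real.exp (2 * ε) * μ x' y
        - 2 * γ * Real.exp ε * ⨅ x, μ x y := by
    intro y
    rw [hω]
    have h1 := hle x y
    have h2 := hle x' y
    have h3 := hge x y
    have h4 := hge x' y
    have h5 := hμ0 x y
    have h6 := hμ0 x' y
    have h0 := hm0 y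
    have e2 : Real.exp (2 * ε) = Real.exp ε ^ 2 := by rw [← Real.exp_nat_mul]; norm_num
    rw [e2]
    have hF := Real.exp_pos ε
    generalize (⨅ x, μ x y) = m at *
    generalize μ x y = a at *
    generalize μ x' y = b at *
    generalize Real.exp ε = F at *
    generalize Real.exp ε₀ = E at *
    rcases h0.eq_or_lt with h | h
    · subst h
      have ha : a = 0 := by linarith
      have hb : b = 0 := by linarith
      simp [ha, hb]
    · have : m / γ * ((a - F * b) / (m / γ)) ^ 2 = γ * ((a - F * b) ^ 2 / m) := by
        field_simp
      rw [this]
      have : (a - F * b) ^ 2 / m ≤ E * a + E * F ^ 2 * b - 2 * F * m := by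
        rw [div_le_iff₀ h]
        have q1 : a * a ≤ a * (E * m) := mul_le_mul_of_nonneg_left h3 h5
        have q2 : F ^ 2 * (b * b) ≤ F ^ 2 * (b * (E * m)) :=
          mul_le_mul_of_nonneg_left (mul_le_mul_of_nonneg_left h4 h6) (by positivity)
        have q3 : F * (m * m) ≤ F * (a * b) :=
          mul_le_mul_of_nonneg_left (mul_le_mul h1 h2 h.le h5) hF.le
        nlinarith
      have := mul_le_mul_of_nonneg_left this hγ0.le
      linarith
  refine (Finset.sum_le_sum fun y _ => key y).trans ?_
  rw [Finset.sum_sub_distrib, Finset.sum_add_distrib, ← Finset.mul_sum, ← Finset.mul_sum,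
    ← Finset.mul_sum, hμ1, hμ1, ← hγ]
  have h : Real.exp (ε - 2 * ε₀) ≤ Real.exp ε := Real.exp_le_exp.mpr (by linarith)
  have := mul_le_mul_of_nonneg_left h (by positivity : 0 ≤ 2 * γ ^ 2)
  nlinarith
end

section
/- Let (μ_x)_{x∈X} be a nonempty family of probability mass functions on a finite set Y such that for all x, x′ ∈ X and all y ∈ Y, μ_x(y) ≤ e^{ε₀}·μ_{x′}(y), let γ = Σ_{y∈Y} inf_{x∈X} μ_x(y) > 0 and ω(y) = inf_{x∈X} μ_x(y)/γ. Let n ≥ 1 and d ∈ ℕ, and let A be the algorithm that, on input (x_1,…,x_n) ∈ X^n, draws Y_i ∼ μ_{x_i} independently for i = 1,…,n, draws d additional independent samples from ω, and outputs the multiset of the n+d results. Then A is (ε,δ)-differentially private with respect to inputs differing in one coordinate, for any ε > 0 and δ satisfying (1/(γn)) · Σ_{m=1}^{n} (m/(m+d)) · C(n,m) · γ^m · (1−γ)^{n−m} · (b²/(4a)) · exp(−2(m+d)·a²/b²) ≤ δ, where a = e^ε − 1 and b = γ·(1+e^ε)·(e^{ε₀} − e^{−ε₀}). -/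
open MvPolynomial in
noncomputable def tgen {Y : Type*} [Fintype Y] (w : Y → ℝ) : MvPolynomial Y ℝ :=
  ∑ y, w y • (X y : MvPolynomial Y ℝ)

open MvPolynomial in
theorem tgen_prod {Y ι : Type*} [Fintype Y] [Fintype ι] [DecidableEq ι]
    (w : ι → Y → ℝ) :
    ∏ i, tgen (w i) = ∑ f : ι → Y, (∏ i, w i (f i)) • ∏ i, (X (f i) : MvPolynomial Y ℝ) := by
  unfold tgen
  rw [Finset.prod_univ_sum, Fintype.piFinset_univ]
  refine Finset.sum_congr rfl fun f _ => ?_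
  rw [Finset.prod_smul]

open MvPolynomial in
theorem prod_X_mon {Y ι : Type*} [Fintype ι] (f : ι → Y) :
    ∏ i, (X (f i) : MvPolynomial Y ℝ) = monomial (∑ i, Finsupp.single (f i) 1) 1 := by
  rw [monomial_sum_one]
  rfl

theorem hoeffding_fin {Y : Type*} [Fintype Y] (ω L : Y → ℝ) (h0 : ∀ y, 0 ≤ ω y)
    (h1 : ∑ y, ω y = 1) (l u : ℝ) (hL : ∀ y, ω y ≠ 0 → L y ∈ Set.Icc l u) (s : ℝ) :
    ∑ y, ω y * Real.exp (s * L y) ≤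
      Real.exp (s * (∑ y, ω y * L y) + (u - l) ^ 2 * s ^ 2 / 8) := by
  let _ : MeasurableSpace Y := ⊤
  have : MeasurableSingletonClass Y := ⟨fun _ => trivial⟩
  let P : MeasureTheory.Measure Y :=
    ∑ y, ENNReal.ofReal (ω y) • MeasureTheory.Measure.dirac y
  have hint : ∀ F : Y → ℝ, ∫ y, F y ∂P = ∑ y, ω y * F y := by
    intro F
    rw [MeasureTheory.integral_finsetSum_measure]
    · refine Finset.sum_congr rfl fun y _ => ?_
      rw [MeasureTheory.integral_smul_measure, MeasureTheory.integral_dirac,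
        ENNReal.toReal_ofReal (h0 y), smul_eq_mul]
    · intro y _
      exact (MeasureTheory.integrable_dirac (by simp)).smul_measure (by simp)
  have : MeasureTheory.IsProbabilityMeasure P := by
    constructor
    simp only [P, MeasureTheory.Measure.coe_finsetSum, Finset.sum_apply,
      MeasureTheory.Measure.smul_apply, MeasureTheory.measure_univ, smul_eq_mul, mul_one]
    rw [← ENNReal.ofReal_sum_of_nonneg (fun y _ => h0 y), h1, ENNReal.ofReal_one]
  have hae : ∀ᵐ y ∂P, L y ∈ Set.Icc l u := by
    rw [MeasureTheory.ae_iff]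
    simp only [P, MeasureTheory.Measure.coe_finsetSum, Finset.sum_apply,
      MeasureTheory.Measure.smul_apply, smul_eq_mul]
    refine Finset.sum_eq_zero fun y _ => ?_
    by_cases hy : ω y = 0
    · simp [hy]
    · rw [MeasureTheory.Measure.dirac_apply]
      have := hL y hy
      simp [Set.indicator, this.1, this.2]
  have key := (ProbabilityTheory.hasSubgaussianMGF_of_mem_Icc
    (measurable_from_top.aemeasurable) hae).mgf_le s
  unfold ProbabilityTheory.mgf at key
  rw [hint, hint] at key
  have e : ∀ y, ω y * Real.exp (s * (L y - ∑ y, ω y * L y)) =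
      Real.exp (-(s * ∑ y, ω y * L y)) * (ω y * Real.exp (s * L y)) := by
    intro y
    rw [mul_sub, sub_eq_add_neg, Real.exp_add]; ring
  simp only [e] at key
  rw [← Finset.mul_sum] at key
  have k2 := mul_le_mul_of_nonneg_left key (Real.exp_pos (s * ∑ y, ω y * L y)).le
  rw [← mul_assoc, ← Real.exp_add, ← Real.exp_add, add_neg_cancel, Real.exp_zero, one_mul] at k2
  refine k2.trans (le_of_eq ?_)
  congr 2
  push_cast
  rw [div_pow, Real.norm_eq_abs, sq_abs]
  ring

open MvPolynomial in
theorem main_lin {Y : Type*} [Fintype Y] (ω L : Y → ℝ) (h0 : ∀ y, 0 ≤ ω y)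
    (Ψ : MvPolynomial Y ℝ →ₗ[ℝ] ℝ) (c : ℝ)
    (hΨ : ∀ s, 0 ≤ Ψ (monomial s 1) ∧ Ψ (monomial s 1) ≤ c) (k : ℕ) :
    ((k : ℝ) + 1) * Ψ (tgen (fun y => L y * ω y) * tgen ω ^ k) ≤
      c * ∑ f : Fin (k+1) → Y, (∏ i, ω (f i)) * max (∑ i, L (f i)) 0 := by
  have e1 : ((k : ℝ) + 1) • (tgen (fun y => L y * ω y) * tgen ω ^ k) =
      ∑ f : Fin (k+1) → Y, ((∏ i, ω (f i)) * (∑ i, L (f i))) •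
        ∏ i, (X (f i) : MvPolynomial Y ℝ) := by
    have e2 : ∀ i : Fin (k+1), tgen (fun y => L y * ω y) * tgen ω ^ k =
        ∏ j, tgen (fun y => (if j = i then L y else 1) * ω y) := by
      intro i
      rw [← Finset.mul_prod_erase _ _ (Finset.mem_univ i)]
      simp only [if_true]
      congr 1
      rw [Finset.prod_congr rfl (g := fun _ => tgen ω)]
      · simp
      · intro j hj
        simp [Finset.ne_of_mem_erase hj]
    have e3 : ((k : ℝ) + 1) • (tgen (fun y => L y * ω y) * tgen ω ^ k) =
        ∑ i : Fin (k+1), ∏ j, tgen (fun y => (if j = i then L y else 1) * ω y) := by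
      simp only [← e2]
      simp [← Nat.cast_smul_eq_nsmul ℝ]
    rw [e3]
    simp only [tgen_prod]
    rw [Finset.sum_comm]
    refine Finset.sum_congr rfl fun f _ => ?_
    rw [← Finset.sum_smul]
    congr 1
    rw [Finset.mul_sum]
    refine Finset.sum_congr rfl fun i _ => ?_
    rw [Finset.prod_mul_distrib, mul_comm]
    simp
  have e4 := congrArg Ψ e1
  rw [map_smul, smul_eq_mul, map_sum] at e4
  rw [e4, Finset.mul_sum]
  refine Finset.sum_le_sum fun f _ => ?_
  rw [map_smul, smul_eq_mul, prod_X_mon]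
  obtain ⟨p0, p1⟩ := hΨ (∑ i, Finsupp.single (f i) 1)
  have q0 : 0 ≤ ∏ i, ω (f i) := Finset.prod_nonneg fun i _ => h0 _
  have m1 := le_max_left (∑ i, L (f i)) 0
  have m2 := le_max_right (∑ i, L (f i)) 0
  calc _ ≤ (∏ i, ω (f i)) * max (∑ i, L (f i)) 0 * Ψ (monomial (∑ i, Finsupp.single (f i) 1) 1) := by
        gcongr
    _ ≤ (∏ i, ω (f i)) * max (∑ i, L (f i)) 0 * c := by
        gcongr
    _ = _ := by ring

theorem exp_bound {Y : Type*} [Fintype Y] (ω L : Y → ℝ) (h0 : ∀ y, 0 ≤ ω y)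
    (s : ℝ) (hs : 0 < s) (K : ℕ) :
    ∑ f : Fin K → Y, (∏ i, ω (f i)) * max (∑ i, L (f i)) 0 ≤
      s⁻¹ * (∑ y, ω y * Real.exp (s * L y)) ^ K := by
  rw [Fintype.sum_pow, Finset.mul_sum]
  refine Finset.sum_le_sum fun f _ => ?_
  rw [Finset.prod_mul_distrib, ← Real.exp_sum, ← Finset.mul_sum]
  have q0 : 0 ≤ ∏ i, ω (f i) := Finset.prod_nonneg fun i _ => h0 _
  have : max (∑ i, L (f i)) 0 ≤ s⁻¹ * Real.exp (s * ∑ i, L (f i)) := by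
    apply max_le
    · rw [← div_eq_inv_mul, le_div_iff₀ hs]
      have := Real.add_one_le_exp (s * ∑ i, L (f i))
      linarith
    · positivity
  calc _ ≤ (∏ i, ω (f i)) * (s⁻¹ * Real.exp (s * ∑ i, L (f i))) := by gcongr
    _ = _ := by ring

open MvPolynomial in
theorem mass_bound {Y ι : Type*} [Fintype Y] [DecidableEq ι] (Φ : MvPolynomial Y ℝ →ₗ[ℝ] ℝ)
    (hΦ : ∀ s, 0 ≤ Φ (monomial s 1) ∧ Φ (monomial s 1) ≤ 1) (ρ : ι → Y → ℝ)
    (hρ : ∀ i y, 0 ≤ ρ i y) (B : Finset ι) :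
    ∀ s, 0 ≤ Φ (monomial s 1 * ∏ i ∈ B, tgen (ρ i)) ∧
      Φ (monomial s 1 * ∏ i ∈ B, tgen (ρ i)) ≤ ∏ i ∈ B, ∑ y, ρ i y := by
  induction B using Finset.induction_on with
  | empty => intro s; simpa using hΦ s
  | insert j B hj ih =>
    intro s
    rw [Finset.prod_insert hj, Finset.prod_insert hj]
    have e : monomial s (1:ℝ) * (tgen (ρ j) * ∏ i ∈ B, tgen (ρ i)) =
        ∑ y, ρ j y • (monomial (s + Finsupp.single y 1) 1 * ∏ i ∈ B, tgen (ρ i)) := by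
      conv_lhs => rw [tgen, ← mul_assoc, Finset.mul_sum, Finset.sum_mul]
      refine Finset.sum_congr rfl fun y _ => ?_
      rw [mul_smul_comm, smul_mul_assoc, X, monomial_mul, one_mul]
    rw [e, map_sum]
    simp only [map_smul, smul_eq_mul]
    constructor
    · exact Finset.sum_nonneg fun y _ => mul_nonneg (hρ j y) (ih _).1
    · rw [Finset.sum_mul]
      exact Finset.sum_le_sum fun y _ => mul_le_mul_of_nonneg_left (ih _).2 (hρ j y)

theorem tgen_smul_add {Y : Type*} [Fintype Y] (c : ℝ) (v w : Y → ℝ) :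
    tgen (fun y => c * v y + w y) = c • tgen v + tgen w := by
  simp [tgen, add_smul, mul_smul, Finset.sum_add_distrib, Finset.smul_sum]

open MvPolynomial in
theorem ofFn_toMultiset {Y : Type*} [DecidableEq Y] {n : ℕ} (f : Fin n → Y) :
    Finsupp.toMultiset (∑ i, Finsupp.single (f i) 1) = (↑(List.ofFn f) : Multiset Y) := by
  rw [map_sum]
  simp only [Finsupp.toMultiset_single, one_smul]
  rw [← Fin.sum_ofFn]
  rw [show List.ofFn (fun i => ({f i} : Multiset Y)) = (List.ofFn f).map (fun y => {y}) from by
    rw [List.map_ofFn]; rfl]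
  have := Multiset.sum_map_singleton (↑(List.ofFn f) : Multiset Y)
  simpa using this


/-- Amplification via shuffling with dummies for a generic `ε₀`-DP local randomizer with
total variation similarity `γ` and blanket `ω`: the algorithm that draws `Y_i ∼ μ_{x_i}`
independently, adds `d` independent samples from `ω`, and outputs the multiset of the
`n + d` results is `(ε,δ)`-DP with respect to inputs differing in one coordinate, for any
`ε > 0` and any `δ` at least the stated bound, where `a = e^ε - 1` and
`b = γ·(1+e^ε)·(e^{ε₀} - e^{-ε₀})`. -/
theorem stmt15 {X Y : Type*} [Fintype Y] [DecidableEq Y] [Nonempty X]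
    (ε₀ : ℝ) (μ : X → Y → ℝ)
    (hμ0 : ∀ x y, 0 ≤ μ x y) (hμ1 : ∀ x, ∑ y, μ x y = 1)
    (hdp : ∀ x x' y, μ x y ≤ Real.exp ε₀ * μ x' y)
    (γ : ℝ) (hγ : γ = ∑ y, ⨅ x, μ x y) (hγ0 : 0 < γ)
    (ω : Y → ℝ) (hω : ∀ y, ω y = (⨅ x, μ x y) / γ)
    (n : ℕ) (hn : 1 ≤ n) (d : ℕ)
    (P : (Fin n → X) → Multiset Y → ℝ)
    (hP : ∀ x S, P x S = ∑ f : Fin n → Y, ∑ g : Fin d → Y,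
      (∏ i, μ (x i) (f i)) * (∏ j, ω (g j)) *
        (if (↑(List.ofFn f) : Multiset Y) + (↑(List.ofFn g) : Multiset Y) = S
         then 1 else 0))
    (ε δ : ℝ) (hε : 0 < ε)
    (a b : ℝ) (ha : a = Real.exp ε - 1)
    (hb : b = γ * (1 + Real.exp ε) * (Real.exp ε₀ - Real.exp (-ε₀)))
    (hδ : (1 / (γ * (n : ℝ))) * ∑ m ∈ Finset.Icc 1 n,
        ((m : ℝ) / ((m : ℝ) + (d : ℝ))) * ((n.choose m : ℕ) : ℝ) * γ ^ m *
          (1 - γ) ^ (n - m) * (b ^ 2 / (4 * a)) *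
          Real.exp (-(2 * ((m : ℝ) + (d : ℝ)) * a ^ 2) / b ^ 2) ≤ δ)
    (x x' : Fin n → X) (i₀ : Fin n) (hneq : x i₀ ≠ x' i₀)
    (hsame : ∀ i, i ≠ i₀ → x i = x' i)
    (𝒪 : Finset (Multiset Y)) :
    ∑ S ∈ 𝒪, P x S ≤ Real.exp ε * ∑ S ∈ 𝒪, P x' S + δ := by
  obtain ⟨n, rfl⟩ : ∃ n', n = n' + 1 := ⟨n - 1, by omega⟩
  have hbdd : ∀ y, BddBelow (Set.range fun x => μ x y) := fun y =>
    ⟨0, by rintro _ ⟨z, rfl⟩; exact hμ0 z y⟩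
  have hI : ∀ y, γ * ω y = ⨅ x, μ x y := fun y => by rw [hω]; field_simp
  have hω0 : ∀ y, 0 ≤ ω y := fun y => by
    rw [hω]; exact div_nonneg (Real.iInf_nonneg fun z => hμ0 z y) hγ0.le
  have hω1 : ∑ y, ω y = 1 := by
    simp only [hω]; rw [← Finset.sum_div, ← hγ]; exact div_self hγ0.ne'
  have hlow : ∀ z y, γ * ω y ≤ μ z y := fun z y => by
    rw [hI]; exact ciInf_le (hbdd y) z
  have hup : ∀ z y, μ z y ≤ Real.exp ε₀ * (γ * ω y) := fun z y => by
    have : Real.exp (-ε₀) * μ z y ≤ γ * ω y := by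
      rw [hI]
      refine le_ciInf fun z' => ?_
      have h := mul_le_mul_of_nonneg_left (hdp z z' y) (Real.exp_pos (-ε₀)).le
      rwa [← mul_assoc, ← Real.exp_add, neg_add_cancel, Real.exp_zero, one_mul] at h
    have h := mul_le_mul_of_nonneg_left this (Real.exp_pos ε₀).le
    rwa [← mul_assoc, ← Real.exp_add, add_neg_cancel, Real.exp_zero, one_mul] at h
  have hε₀ : 0 ≤ ε₀ := by
    obtain ⟨z⟩ := ‹Nonempty X›
    have h : ∑ y, μ z y ≤ ∑ y, Real.exp ε₀ * μ z y := Finset.sum_le_sum fun y _ => hdp z z y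
    rw [← Finset.mul_sum, hμ1, mul_one] at h
    exact Real.one_le_exp_iff.1 h
  have ha0 : 0 < a := by rw [ha]; linarith [Real.add_one_le_exp ε]
  have hγ1 : γ ≤ 1 := by
    obtain ⟨z⟩ := ‹Nonempty X›
    have h : ∑ y, γ * ω y ≤ ∑ y, μ z y := Finset.sum_le_sum fun y _ => hlow z y
    rwa [← Finset.mul_sum, hμ1, hω1, mul_one] at h
  set lam : Y → ℝ := fun y => -Real.exp ε * μ (x' i₀) y + μ (x i₀) y with hlam
  set L : Y → ℝ := fun y => lam y / ω y with hL
  have hLω : lam = fun y => L y * ω y := by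
    funext y
    by_cases h : ω y = 0
    · have h1 := hup (x i₀) y
      have h2 := hup (x' i₀) y
      have h3 := hμ0 (x i₀) y
      have h4 := hμ0 (x' i₀) y
      simp only [h, mul_zero] at h1 h2
      simp [hlam, le_antisymm h1 h3, le_antisymm h2 h4, h]
    · simp only [hL]; field_simp
  have hmean : ∑ y, ω y * L y = -a := by
    have : ∀ y, ω y * L y = lam y := fun y => by rw [hLω]; ring
    simp only [this, hlam, Finset.sum_add_distrib, ← Finset.mul_sum, hμ1, ha]; ring
  have hE : ∀ k : ℕ, ∑ f : Fin (k+1) → Y, (∏ i, ω (f i)) * max (∑ i, L (f i)) 0 ≤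
      (b ^ 2 / (4 * a)) * Real.exp (-(2 * ((k : ℝ) + 1) * a ^ 2) / b ^ 2) := by
    intro k
    by_cases hb0 : b = 0
    · have he : Real.exp ε₀ = Real.exp (-ε₀) := by
        rw [hb] at hb0
        have h1 : 0 < γ * (1 + Real.exp ε) := by positivity
        have := (mul_eq_zero.1 hb0).resolve_left h1.ne'
        linarith
      have hz : ε₀ = 0 := by have := Real.exp_injective he; linarith
      have hLn : ∀ y, L y ≤ 0 := by
        intro y
        refine div_nonpos_of_nonpos_of_nonneg ?_ (hω0 y)
        have h1 := hdp (x i₀) (x' i₀) y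
        rw [hz, Real.exp_zero] at h1
        have h2 := hμ0 (x' i₀) y
        simp only [hlam]
        rw [ha] at ha0
        nlinarith
      rw [hb0]
      have : ∀ f : Fin (k+1) → Y, max (∑ i, L (f i)) 0 = 0 := fun f =>
        max_eq_right (Finset.sum_nonpos fun i _ => hLn _)
      simp [this]
    · have hs : 0 < 4 * a / b ^ 2 := by positivity
      refine (exp_bound ω L hω0 _ hs (k+1)).trans ?_
      have hH := hoeffding_fin ω L hω0 hω1 (γ * (1 - Real.exp ε * Real.exp ε₀))
        (γ * (1 - Real.exp ε * Real.exp ε₀) + b) (by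
          intro y hy
          have hyp : 0 < ω y := lt_of_le_of_ne (hω0 y) (Ne.symm hy)
          have e1 := hlow (x i₀) y
          have e2 := hup (x i₀) y
          have e3 := hlow (x' i₀) y
          have e4 := hup (x' i₀) y
          have e5 := Real.exp_pos ε
          have f1 := mul_le_mul_of_nonneg_left e3 e5.le
          have f2 := mul_le_mul_of_nonneg_left e4 e5.le
          constructor
          · simp only [hL, hlam]
            rw [le_div_iff₀ hyp]
            linarith
          · simp only [hL, hlam]
            rw [div_le_iff₀ hyp]
            have e6 : Real.exp (-ε₀) ≤ 1 := Real.exp_le_one_iff.2 (by linarith)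
            have e7 : 0 ≤ γ * ω y * ((1 + Real.exp ε) * (1 - Real.exp (-ε₀))) := by
              have : 0 ≤ 1 - Real.exp (-ε₀) := by linarith
              positivity
            rw [hb]
            linarith) (4 * a / b ^ 2)
      have hn0 : 0 ≤ ∑ y, ω y * Real.exp (4 * a / b ^ 2 * L y) :=
        Finset.sum_nonneg fun y _ => mul_nonneg (hω0 y) (Real.exp_pos _).le
      have hp := pow_le_pow_left₀ hn0 hH (k+1)
      have hp2 := mul_le_mul_of_nonneg_left hp (inv_pos.2 hs).le
      refine hp2.trans (le_of_eq ?_)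
      rw [inv_div, ← Real.exp_nat_mul, hmean]
      congr 2
      push_cast
      field_simp
      ring
  let Φ : MvPolynomial Y ℝ →ₗ[ℝ] ℝ := (MvPolynomial.basisMonomials Y ℝ).constr ℝ
    (fun s => if Finsupp.toMultiset s ∈ 𝒪 then (1:ℝ) else 0)
  have hΦm : ∀ s, Φ (MvPolynomial.monomial s 1) =
      if Finsupp.toMultiset s ∈ 𝒪 then (1:ℝ) else 0 := by
    intro s
    have := (MvPolynomial.basisMonomials Y ℝ).constr_basis ℝ
      (fun s => if Finsupp.toMultiset s ∈ 𝒪 then (1:ℝ) else 0) s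
    rwa [MvPolynomial.coe_basisMonomials] at this
  have hΦ : ∀ s, 0 ≤ Φ (MvPolynomial.monomial s 1) ∧ Φ (MvPolynomial.monomial s 1) ≤ 1 := by
    intro s
    rw [hΦm]
    split_ifs <;> norm_num
  have hPs : ∀ z : Fin (n+1) → X, ∑ S ∈ 𝒪, P z S =
      Φ ((∏ i, tgen (μ (z i))) * tgen ω ^ d) := by
    intro z
    have e : tgen ω ^ d = ∏ _j : Fin d, tgen ω := by simp
    rw [e, tgen_prod, tgen_prod, Finset.sum_mul_sum, map_sum]
    simp only [hP]
    rw [Finset.sum_comm]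
    refine Finset.sum_congr rfl fun f _ => ?_
    rw [Finset.sum_comm, map_sum]
    refine Finset.sum_congr rfl fun g _ => ?_
    rw [smul_mul_smul_comm, map_smul, smul_eq_mul, ← Finset.mul_sum, prod_X_mon, prod_X_mon,
      MvPolynomial.monomial_mul, one_mul, hΦm, map_add, ofFn_toMultiset, ofFn_toMultiset,
      Finset.sum_ite_eq]
  set s : Finset (Fin (n+1)) := Finset.univ.erase i₀ with hs
  have hcard : s.card = n := by simp [hs]
  set ρ : Fin (n+1) → Y → ℝ := fun i y => μ (x i) y - γ * ω y with hρ
  have hρ0 : ∀ i y, 0 ≤ ρ i y := fun i y => sub_nonneg.2 (hlow _ _)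
  have hρ1 : ∀ i, ∑ y, ρ i y = 1 - γ := fun i => by
    simp only [hρ, Finset.sum_sub_distrib, ← Finset.mul_sum, hμ1, hω1, mul_one]
  have hdiff : ∑ S ∈ 𝒪, P x S - Real.exp ε * ∑ S ∈ 𝒪, P x' S =
      ∑ B ∈ s.powerset, γ ^ B.card *
        Φ ((tgen lam * tgen ω ^ (B.card + d)) * ∏ i ∈ s \ B, tgen (ρ i)) := by
    have e1 : ∏ i, tgen (μ (x i)) = tgen (μ (x i₀)) * ∏ i ∈ s, tgen (μ (x i)) :=
      (Finset.mul_prod_erase _ _ (Finset.mem_univ i₀)).symm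
    have e2 : ∏ i, tgen (μ (x' i)) = tgen (μ (x' i₀)) * ∏ i ∈ s, tgen (μ (x i)) := by
      rw [← Finset.mul_prod_erase _ _ (Finset.mem_univ i₀)]
      congr 1
      exact Finset.prod_congr rfl fun i hi => by rw [hsame i (Finset.ne_of_mem_erase hi)]
    have e3 : ∏ i ∈ s, tgen (μ (x i)) = ∑ B ∈ s.powerset,
        γ ^ B.card • (tgen ω ^ B.card * ∏ i ∈ s \ B, tgen (ρ i)) := by
      have : ∀ i, tgen (μ (x i)) = γ • tgen ω + tgen (ρ i) := fun i => by
        rw [← tgen_smul_add]; congr 1; funext y; simp [hρ]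
      simp only [this]
      rw [Finset.prod_add]
      refine Finset.sum_congr rfl fun B _ => ?_
      rw [Finset.prod_const, smul_pow, smul_mul_assoc]
    rw [hPs, hPs, ← smul_eq_mul (Real.exp ε), ← map_smul, ← map_sub]
    have e4 : (∏ i, tgen (μ (x i))) * tgen ω ^ d -
        Real.exp ε • ((∏ i, tgen (μ (x' i))) * tgen ω ^ d) =
        ∑ B ∈ s.powerset, γ ^ B.card •
          ((tgen lam * tgen ω ^ (B.card + d)) * ∏ i ∈ s \ B, tgen (ρ i)) := by
      have e5 : tgen lam = -Real.exp ε • tgen (μ (x' i₀)) + tgen (μ (x i₀)) := by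
        rw [hlam, ← tgen_smul_add]
      calc _ = tgen lam * (∏ i ∈ s, tgen (μ (x i))) * tgen ω ^ d := by
            rw [e1, e2, e5]
            simp only [MvPolynomial.smul_eq_C_mul, map_neg]
            ring
        _ = _ := by
            rw [e3, Finset.mul_sum, Finset.sum_mul]
            refine Finset.sum_congr rfl fun B _ => ?_
            simp only [MvPolynomial.smul_eq_C_mul, pow_add]
            ring
    rw [e4, map_sum]
    simp only [map_smul, smul_eq_mul]
  set G : ℕ → ℝ := fun m => γ ^ m * ((1 - γ) ^ (n - m) * ((b ^ 2 / (4 * a)) *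
      Real.exp (-(2 * (((m + d : ℕ) : ℝ) + 1) * a ^ 2) / b ^ 2)) / (((m + d : ℕ) : ℝ) + 1)) with hG
  have hterm : ∀ B ∈ s.powerset, γ ^ B.card *
      Φ ((tgen lam * tgen ω ^ (B.card + d)) * ∏ i ∈ s \ B, tgen (ρ i)) ≤ G B.card := by
    intro B hB
    have hBs := Finset.mem_powerset.1 hB
    refine mul_le_mul_of_nonneg_left ?_ (by positivity)
    have hk : (0:ℝ) < ((B.card + d : ℕ) : ℝ) + 1 := by positivity
    rw [le_div_iff₀ hk, mul_comm]
    have hm := main_lin ω L hω0 (Φ ∘ₗ LinearMap.mulRight ℝ (∏ i ∈ s \ B, tgen (ρ i)))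
      ((1 - γ) ^ (n - B.card)) (by
        intro t
        have := mass_bound Φ hΦ ρ hρ0 (s \ B) t
        simp only [hρ1, Finset.prod_const, Finset.card_sdiff_of_subset hBs, hcard] at this
        simpa using this) (B.card + d)
    rw [← hLω] at hm
    refine hm.trans (mul_le_mul_of_nonneg_left (hE _) (pow_nonneg (by linarith) _))
  have hfin : ∑ B ∈ s.powerset, G B.card ≤ δ := by
    rw [Finset.sum_powerset_apply_card, hcard]
    refine le_trans (le_of_eq ?_) hδ
    rw [Finset.mul_sum, Finset.range_eq_Ico, Finset.sum_Ico_eq_sum_range,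
      ← Finset.Ico_succ_right_eq_Icc, Finset.sum_Ico_eq_sum_range]
    refine Finset.sum_congr (by simp) fun m hm => ?_
    have hc : ((n:ℝ) + 1) * (n.choose m : ℝ) = ((n+1).choose (m+1) : ℝ) * ((m:ℝ)+1) := by
      exact_mod_cast Nat.add_one_mul_choose_eq n m
    have hc' : (n.choose m : ℝ) = ((n+1).choose (m+1) : ℝ) * ((m:ℝ)+1) / ((n:ℝ)+1) := by
      rw [← hc]; field_simp
    rw [zero_add, add_comm 1 m, Nat.add_sub_add_right, nsmul_eq_mul, hc']
    simp only [hG]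
    push_cast
    rw [show ((m:ℝ) + d + 1) = (m:ℝ) + 1 + d by ring, pow_succ]
    have h1 : (m:ℝ) + 1 + d ≠ 0 := by positivity
    have h2 : (n:ℝ) + 1 ≠ 0 := by positivity
    generalize Real.exp _ = E
    generalize b ^ 2 / (4 * a) = F
    field_simp
    ring
  have := hdiff.le.trans ((Finset.sum_le_sum hterm).trans hfin)
  linarith
end
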